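/- arXiv:2506.20750 — 3 statements merged into one kernel-verified Lean document; each statement's English description precedes it below -/
import Mathlib

section
/- Fix N ≥ 2, A = {1,…,N}, and k distinct one-sided sequences x_1,…,x_k ∈ A^ℕ whose length-n prefixes w_{1,n},…,w_{k,n} are pairwise distinct for every n ≥ 1; let M_n(z) be the k×k matrix with (i,j) entry the correlation polynomial (w_{j,n}, w_{i,n})_z. Then for every real z > 1 the entrywise limit α(z) = lim_{n→∞} z^{−n} M_n(z) exists, and for every real z > k the matrix α(z) is invertible. -/
open Filter Topology

section Correlation

variable {A : Type*}

/-- `ℓ ∈ (u,w)`: overlap condition when the first symbol of `w` is placed below the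
`(|u|-ℓ)`-th symbol of `u` (1-indexed); the overlapping parts agree. -/
def corrIdx (u w : List A) (ℓ : ℕ) : Prop :=
  ℓ < u.length ∧
    ∀ j : ℕ, j ≤ ℓ → j < w.length → u[u.length - 1 - ℓ + j]? = w[j]?

/-- The correlation set `(u,w) ⊆ {0,…,|u|−1}`. -/
def corrSet (u w : List A) : Set ℕ := { ℓ | corrIdx u w ℓ }

open scoped Classical in
/-- The correlation set, as a finset. -/
noncomputable def corrFinset (u w : List A) : Finset ℕ :=
  (Finset.range u.length).filter (corrIdx u w)

/-- The correlation polynomial `(u,w)_z = Σ_{ℓ ∈ (u,w)} z^ℓ`. -/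
noncomputable def corrPoly (u w : List A) (z : ℝ) : ℝ :=
  ∑ ℓ ∈ corrFinset u w, z ^ ℓ

end Correlation

/-- The length-`n` prefix `x_1 ⋯ x_n` of a one-sided sequence. -/
def prefixWord {A : Type*} (x : ℕ → A) (n : ℕ) : List A := (List.range n).map x

/-- The correlation matrix `M_n(z)` of the length-`n` prefixes of `k` one-sided
sequences: `(i,j)` entry `(w_{j,n}, w_{i,n})_z`. -/
noncomputable def corrMatrix {N k : ℕ} (x : Fin k → ℕ → Fin N) (n : ℕ) (z : ℝ) :
    Matrix (Fin k) (Fin k) ℝ :=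
  Matrix.of fun i j => corrPoly (prefixWord (x j) n) (prefixWord (x i) n) z

section Limit

variable {A : Type*}

theorem corrIdx_prefixWord_iff (u w : ℕ → A) {n m : ℕ} (hm : m < n) :
    corrIdx (prefixWord u n) (prefixWord w n) (n - 1 - m) ↔
      ∀ t, m + t < n → u (m + t) = w t := by
  have hlen : n - 1 - (n - 1 - m) = m := by omega
  simp only [corrIdx, prefixWord, List.length_map, List.length_range, hlen]
  constructor
  · rintro ⟨-, h⟩ t ht
    have := h t (by omega) (by omega)
    simpa [List.getElem?_range ht, List.getElem?_range (show t < n by omega)] using this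
  · refine fun h => ⟨by omega, fun t ht htn => ?_⟩
    have hmt : m + t < n := by omega
    simpa [List.getElem?_range hmt, List.getElem?_range htn] using h t hmt

open scoped Classical in
/-- The limit of `z⁻ⁿ (u_n, w_n)_z` for the length-`n` prefixes `u_n`, `w_n`: the sum of
`z^{-(m+1)}` over the shifts `m` with `σ^m u = w`. -/
noncomputable def corrLimit (u w : ℕ → A) (z : ℝ) : ℝ :=
  ∑' m : ℕ, if ∀ t, u (m + t) = w t then z⁻¹ ^ (m + 1) else 0

open scoped Classical in
theorem corrPoly_prefixWord_div_pow (u w : ℕ → A) (n : ℕ) {z : ℝ} (hz : 0 < z) :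
    corrPoly (prefixWord u n) (prefixWord w n) z / z ^ n =
      ∑' m : ℕ, if m < n ∧ ∀ t, m + t < n → u (m + t) = w t then z⁻¹ ^ (m + 1) else 0 := by
  have hlen : (prefixWord u n).length = n := by simp [prefixWord]
  rw [tsum_eq_sum (s := Finset.range n)
    fun m hm => if_neg fun h => hm (Finset.mem_range.2 h.1)]
  rw [corrPoly, corrFinset, Finset.sum_filter, hlen, ← Finset.sum_range_reflect,
    Finset.sum_div]
  refine Finset.sum_congr rfl fun m hm => ?_
  have hm := Finset.mem_range.1 hm
  simp only [corrIdx_prefixWord_iff u w hm, hm, true_and]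
  split_ifs
  · rw [inv_pow, div_eq_iff (by positivity), eq_comm, inv_mul_eq_iff_eq_mul₀ (by positivity),
      ← pow_add]
    congr 1
    omega
  · simp

theorem summable_inv_pow_succ {z : ℝ} (hz : 1 < z) : Summable fun m : ℕ => z⁻¹ ^ (m + 1) :=
  (summable_nat_add_iff 1).2
    (summable_geometric_of_lt_one (by positivity) (inv_lt_one_of_one_lt₀ hz))

open scoped Classical in
theorem summable_ite_inv_pow_succ {z : ℝ} (hz : 1 < z) (p : ℕ → Prop) :
    Summable fun m : ℕ => if p m then z⁻¹ ^ (m + 1) else 0 := by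
  refine (summable_inv_pow_succ hz).of_nonneg_of_le (fun m => ?_) fun m => ?_ <;>
    split_ifs <;> first | positivity | exact le_rfl

theorem tendsto_corrPoly_prefixWord (u w : ℕ → A) {z : ℝ} (hz : 1 < z) :
    Tendsto (fun n => corrPoly (prefixWord u n) (prefixWord w n) z / z ^ n) atTop
      (𝓝 (corrLimit u w z)) := by
  classical
  have hz0 : 0 < z := by linarith
  simp only [corrPoly_prefixWord_div_pow u w _ hz0, corrLimit]
  refine tendsto_tsum_of_dominated_convergence (summable_inv_pow_succ hz) (fun m => ?_)
    (Eventually.of_forall fun n m => ?_)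
  · refine tendsto_const_nhds.congr' ?_
    by_cases h : ∀ t, u (m + t) = w t
    · filter_upwards [eventually_gt_atTop m] with n hn
      rw [if_pos h, if_pos ⟨hn, fun t _ => h t⟩]
    · obtain ⟨t, ht⟩ := not_forall.1 h
      filter_upwards [eventually_gt_atTop (m + t)] with n hn
      rw [if_neg h, if_neg fun h' => ht (h'.2 t hn)]
  · have hpos : 0 ≤ z⁻¹ ^ (m + 1) := by positivity
    split_ifs
    · rw [Real.norm_of_nonneg hpos]
    · simpa using hpos

theorem corrLimit_nonneg (u w : ℕ → A) {z : ℝ} (hz : 0 < z) : 0 ≤ corrLimit u w z :=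
  tsum_nonneg fun m => by split_ifs <;> positivity

theorem inv_le_corrLimit_self (u : ℕ → A) {z : ℝ} (hz : 1 < z) : z⁻¹ ≤ corrLimit u u z := by
  classical
  have hz0 : 0 < z := by linarith
  have h := (summable_ite_inv_pow_succ hz fun m => ∀ t, u (m + t) = u t).le_tsum 0
    fun m _ => by split_ifs <;> positivity
  simpa [corrLimit] using h

/-- Each shift of `u` equals at most one of the distinct sequences `x i`, and the zeroth shift
none of those that differ from `u`. -/
theorem sum_corrLimit_le {ι : Type*} (s : Finset ι) (x : ι → ℕ → A)
    (hx : Function.Injective x) (u : ℕ → A) (hu : ∀ i ∈ s, u ≠ x i) {z : ℝ} (hz : 1 < z) :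
    ∑ i ∈ s, corrLimit u (x i) z ≤ z⁻¹ * (z - 1)⁻¹ := by
  classical
  have hz0 : 0 < z := by linarith
  have hs (i : ι) := summable_ite_inv_pow_succ hz fun m => ∀ t, u (m + t) = x i t
  have hgeom : ∑' m : ℕ, z⁻¹ ^ (m + 1 + 1) = z⁻¹ * (z - 1)⁻¹ := by
    simp only [pow_succ, tsum_mul_right]
    rw [tsum_geometric_of_lt_one (by positivity) (inv_lt_one_of_one_lt₀ hz)]
    have : z - 1 ≠ 0 := by linarith
    field_simp
  have hsum := summable_sum fun i (_ : i ∈ s) => hs i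
  simp only [corrLimit]
  rw [← Summable.tsum_finsetSum fun i _ => hs i, hsum.tsum_eq_zero_add, ← hgeom]
  have hzero : (∑ i ∈ s, if ∀ t, u (0 + t) = x i t then z⁻¹ ^ (0 + 1) else 0) = 0 :=
    Finset.sum_eq_zero fun i hi => if_neg fun h => hu i hi (funext fun t => by simpa using h t)
  rw [hzero, zero_add]
  refine Summable.tsum_le_tsum (fun m => ?_)
    (hsum.comp_injective (add_left_injective 1))
    ((summable_inv_pow_succ hz).comp_injective (add_left_injective 1))
  rw [← Finset.sum_filter, Finset.sum_const, nsmul_eq_mul]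
  have hcard : (s.filter fun i => ∀ t, u (m + 1 + t) = x i t).card ≤ 1 :=
    Finset.card_le_one.2 fun i hi j hj => hx <| funext fun t =>
      ((Finset.mem_filter.1 hi).2 t).symm.trans ((Finset.mem_filter.1 hj).2 t)
  exact mul_le_of_le_one_left (by positivity) (Nat.cast_le_one.2 hcard)

end Limit

/-- The entrywise limit `α(z) = lim z^{−n} M_n(z)` exists for all `z > 1`, and `α(z)` is
invertible for all `z > k`. -/
theorem corrMatrix_limit_exists_and_invertible (N k : ℕ) (hN : 2 ≤ N)
    (x : Fin k → ℕ → Fin N)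
    (hdist : ∀ n : ℕ, 1 ≤ n → ∀ i j : Fin k, i ≠ j →
      prefixWord (x i) n ≠ prefixWord (x j) n) :
    ∃ α : ℝ → Matrix (Fin k) (Fin k) ℝ,
      (∀ z : ℝ, 1 < z → ∀ i j : Fin k,
        Filter.Tendsto (fun n : ℕ => corrMatrix x n z i j / z ^ n)
          Filter.atTop (nhds (α z i j))) ∧
      (∀ z : ℝ, (k : ℝ) < z → IsUnit (α z).det) := by
  have hx : Function.Injective x := fun i j hij => by
    by_contra hne
    exact hdist 1 le_rfl i j hne (by rw [hij])
  refine ⟨fun z => Matrix.of fun i j => corrLimit (x j) (x i) z,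
    fun z hz i j => tendsto_corrPoly_prefixWord (x j) (x i) hz, fun z hz => ?_⟩
  rw [isUnit_iff_ne_zero]
  refine det_ne_zero_of_sum_col_lt_diag fun j => ?_
  have hk : 1 ≤ k := j.pos
  have hz1 : 1 < z := lt_of_le_of_lt (by exact_mod_cast hk) hz
  have hz0 : 0 < z := by linarith
  simp only [Matrix.of_apply, Real.norm_of_nonneg (corrLimit_nonneg _ _ hz0)]
  refine lt_of_lt_of_le ?_ (inv_le_corrLimit_self (x j) hz1)
  obtain rfl | hk2 := hk.eq_or_lt
  · rw [Finset.sum_eq_zero fun i hi => absurd (Subsingleton.elim i j) (Finset.ne_of_mem_erase hi)]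
    positivity
  · have hz2 : 2 < z := lt_of_le_of_lt (by exact_mod_cast hk2) hz
    refine (sum_corrLimit_le _ x hx (x j)
      (fun i hi h => Finset.ne_of_mem_erase hi (hx h.symm)) hz1).trans_lt ?_
    exact mul_lt_of_lt_one_right (by positivity) (inv_lt_one_of_one_lt₀ (by linarith))
end

section
/- Fix N ≥ 2, A = {1,…,N}, the full shift X = A^ℤ, and k distinct one-sided sequences x_1,…,x_k ∈ A^ℕ whose length-n prefixes w_{1,n},…,w_{k,n} are pairwise distinct for every n ≥ 1; let K_n = {w_{1,n},…,w_{k,n}} and define λ_n > 0 by h(X_{K_n}) = ln λ_n. Assume α(N) is invertible. Then for all sufficiently large n the matrix M_n(N) is invertible and, with s_n(N) the sum of the entries of M_n(N)^{−1}, the series Σ_{j=1}^∞ N^{n−j} s_n(N)^j converges; moreover both limits below exist and lim_{n→∞} (ln N − ln λ_n)/N^{−n} = lim_{n→∞} Σ_{j=1}^∞ N^{n−j} s_n(N)^j. -/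
open Filter Topology

section SubshiftBasics

variable {A : Type*}

/-- The left shift map on bi-infinite sequences. -/
def shiftZ (x : ℤ → A) : ℤ → A := fun i => x (i + 1)

/-- The word `w` occurs (as a subword) in the bi-infinite sequence `x`. -/
def occursIn (w : List A) (x : ℤ → A) : Prop :=
  ∃ i : ℤ, ∀ k : Fin w.length, x (i + (k : ℕ)) = w.get k

/-- A subshift: a closed, shift-invariant subset of `A^ℤ` (prodiscrete topology). -/
def IsSubshift [TopologicalSpace A] (X : Set (ℤ → A)) : Prop :=
  IsClosed X ∧ ∀ x ∈ X, shiftZ x ∈ X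

/-- The language of `X`: all finite words occurring in points of `X`. -/
def language (X : Set (ℤ → A)) : Set (List A) :=
  { w | ∃ x ∈ X, occursIn w x }

/-- The words of length `n` in the language of `X`. -/
def langN (X : Set (ℤ → A)) (n : ℕ) : Set (List A) :=
  { w | w ∈ language X ∧ w.length = n }

/-- Topological entropy of a subshift, `lim (1/n) log #L_n(X)` (as a limsup,
which agrees with the limit when the latter exists). -/
noncomputable def entropy (X : Set (ℤ → A)) : ℝ :=
  Filter.limsup (fun n : ℕ => Real.log ((langN X n).ncard) / n) Filter.atTop

/-- The perturbation `X_w`: points of `X` not containing `w` as a subword. -/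
def perturb (X : Set (ℤ → A)) (w : List A) : Set (ℤ → A) :=
  { x ∈ X | ¬ occursIn w x }

/-- Multi-word perturbation `X_K`. -/
def perturbFamily (X : Set (ℤ → A)) (K : Set (List A)) : Set (ℤ → A) :=
  { x ∈ X | ∀ w ∈ K, ¬ occursIn w x }

/-- Irreducibility of a subshift. -/
def IrreducibleSubshift (X : Set (ℤ → A)) : Prop :=
  ∀ u ∈ language X, ∀ w ∈ language X, ∃ v, u ++ v ++ w ∈ language X

/-- `m` is a synchronizing word for `X`. -/
def IsSynchronizingWord (X : Set (ℤ → A)) (m : List A) : Prop :=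
  m ∈ language X ∧
    ∀ u v : List A, u ++ m ∈ language X → m ++ v ∈ language X → u ++ m ++ v ∈ language X

/-- A synchronized system: an irreducible subshift possessing a synchronizing word. -/
def IsSynchronizedSystem (X : Set (ℤ → A)) : Prop :=
  IrreducibleSubshift X ∧ ∃ m, IsSynchronizingWord X m

end SubshiftBasics
/-- The collection `K_n` of the length-`n` prefixes of the given sequences. -/
def prefixFamily {N k : ℕ} (x : Fin k → ℕ → Fin N) (n : ℕ) : Set (List (Fin N)) :=
  { v | ∃ i : Fin k, v = prefixWord (x i) n }

/-- `s_n(z)`: the sum of the entries of `M_n(z)⁻¹`. -/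
noncomputable def snSum {N k : ℕ} (x : Fin k → ℕ → Fin N) (n : ℕ) (z : ℝ) : ℝ :=
  ∑ i : Fin k, ∑ j : Fin k, (corrMatrix x n z)⁻¹ i j

section AvoidingWords

variable {A ι : Type*}

/-- The word `v` contains none of the words `w j`. -/
def Avoids (w : ι → List A) (v : List A) : Prop := ∀ j, ¬ w j <:+: v

theorem Avoids.of_infix {w : ι → List A} {u v : List A} (h : Avoids w v) (huv : u <:+: v) :
    Avoids w u := fun j hj => h j (hj.trans huv)

theorem not_avoids_concat_iff {w : ι → List A} {u : List A} (hu : Avoids w u) (c : A) :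
    ¬ Avoids w (u ++ [c]) ↔ ∃ j, w j <:+ u ++ [c] := by
  simp only [Avoids, not_forall, not_not, List.infix_concat_iff]
  exact exists_congr fun j => ⟨fun h => h.resolve_right (hu j), Or.inl⟩

theorem not_avoids_cons_iff {w : ι → List A} {u : List A} (hu : Avoids w u) (c : A) :
    ¬ Avoids w (c :: u) ↔ ∃ j, w j <+: c :: u := by
  simp only [Avoids, not_forall, not_not, List.infix_cons_iff]
  exact exists_congr fun j => ⟨fun h => h.resolve_right (hu j), Or.inl⟩

open scoped Classical in
theorem card_eq_card_avoids_add_sum [Fintype ι] {β : Type*} {w : ι → List A} {n : ℕ}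
    (hlen : ∀ j, (w j).length = n) (hinj : Function.Injective w) (S : Finset β)
    (φ : β → List A) (hS : ∀ s ∈ S, φ s ≠ [] ∧ Avoids w (φ s).dropLast) :
    S.card = (S.filter fun s => Avoids w (φ s)).card +
      ∑ j, (S.filter fun s => w j <:+ φ s).card := by
  rw [← Finset.card_filter_add_card_filter_not (s := S) (fun s => Avoids w (φ s))]
  congr 1
  rw [← Finset.card_biUnion]
  · congr 1
    ext s
    simp only [Finset.mem_filter, Finset.mem_biUnion, Finset.mem_univ, true_and]
    rw [exists_and_left]
    refine and_congr_right fun hs => ?_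
    obtain ⟨hne, hav⟩ := hS s hs
    have := not_avoids_concat_iff hav ((φ s).getLast hne)
    rwa [List.dropLast_append_getLast hne] at this
  · intro i _ j _ hij
    refine Finset.disjoint_filter.2 fun s _ hi hj => hij (hinj ?_)
    exact (List.suffix_of_suffix_length_le hi hj (by simp [hlen])).eq_of_length (by simp [hlen])

theorem lt_length_of_mem_corrFinset {u w : List A} {r : ℕ} (hr : r ∈ corrFinset u w) :
    r < u.length := by
  classical
  exact Finset.mem_range.1 (Finset.mem_filter.1 hr).1

theorem corrIdx_iff {u w : List A} (h : u.length = w.length) (t : ℕ) :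
    corrIdx u w t ↔ t < w.length ∧ w.take (t + 1) <:+ u := by
  rw [corrIdx, h]
  refine and_congr_right fun ht => ?_
  rw [List.suffix_iff_eq_drop, List.length_take, h, Nat.min_eq_left (Nat.succ_le_of_lt ht),
    show w.length - (t + 1) = w.length - 1 - t by omega]
  constructor
  · intro H
    refine List.ext_getElem? fun j => ?_
    rw [List.getElem?_drop, List.getElem?_take]
    split_ifs with hj
    · rw [← H j (by omega) (by omega)]
    · rw [List.getElem?_eq_none (by omega)]
  · intro H j hj _
    have := congrArg (fun l : List A => l[j]?) H
    simp only [List.getElem?_drop, List.getElem?_take] at this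
    rw [if_pos (by omega)] at this
    exact this.symm

variable [Fintype A]

/-- The words of length `m` satisfying `p`. -/
noncomputable def wordsWith (p : List A → Prop) (m : ℕ) : Finset (List A) :=
  ((List.finite_length_eq A m).subset
    (fun _ h => h.1 : {v : List A | v.length = m ∧ p v} ⊆ _)).toFinset

@[simp]
theorem mem_wordsWith {p : List A → Prop} {m : ℕ} {v : List A} :
    v ∈ wordsWith p m ↔ v.length = m ∧ p v := by
  simp [wordsWith]

/-- The number of words of length `m` avoiding all `w j`. -/
noncomputable def avoidCount (w : ι → List A) (m : ℕ) : ℕ := (wordsWith (Avoids w) m).card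

/-- The number of words of length `m + 1` in which the only occurrence of a word of the family
is an occurrence of `w j` at the end. -/
noncomputable def firstHitCount (w : ι → List A) (j : ι) (m : ℕ) : ℕ :=
  (wordsWith (fun v => Avoids w v.dropLast ∧ w j <:+ v) (m + 1)).card

theorem avoidCount_zero {w : ι → List A} {n : ℕ} (hn : 0 < n)
    (hlen : ∀ j, (w j).length = n) : avoidCount w 0 = 1 := by
  rw [avoidCount, Finset.card_eq_one]
  refine ⟨[], ?_⟩
  ext v
  simp only [mem_wordsWith, List.length_eq_zero_iff, Finset.mem_singleton, and_iff_left_iff_imp]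
  rintro rfl j hj
  have := hlen j
  rw [List.infix_nil.1 hj] at this
  simp at this
  omega

theorem firstHitCount_eq_zero {w : ι → List A} {n : ℕ} (hlen : ∀ j, (w j).length = n)
    (j : ι) {m : ℕ} (hm : m + 1 < n) : firstHitCount w j m = 0 := by
  rw [firstHitCount, Finset.card_eq_zero, Finset.eq_empty_iff_forall_notMem]
  intro v hv
  obtain ⟨h1, -, h2⟩ := mem_wordsWith.1 hv
  have := h2.length_le
  rw [hlen] at this
  omega

theorem card_mul_avoidCount [Fintype ι] {w : ι → List A} {n : ℕ}
    (hlen : ∀ j, (w j).length = n) (hinj : Function.Injective w) (m : ℕ) :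
    Fintype.card A * avoidCount w m = avoidCount w (m + 1) + ∑ j, firstHitCount w j m := by
  classical
  have h := card_eq_card_avoids_add_sum hlen hinj
    (Finset.univ ×ˢ wordsWith (Avoids w) m) (fun p : A × List A => p.2 ++ [p.1])
    (by simp)
  have hinj' : Function.Injective (fun p : A × List A => p.2 ++ [p.1]) := by
    rintro ⟨a, u⟩ ⟨b, v⟩ h
    simpa [and_comm] using h
  have hsurj : ∀ v : List A, v.length = m + 1 → ∃ u c, u.length = m ∧ v = u ++ [c] := by
    intro v hv
    have hne : v ≠ [] := by rintro rfl; simp at hv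
    exact ⟨v.dropLast, v.getLast hne, by simp [hv], (List.dropLast_append_getLast hne).symm⟩
  rw [Finset.card_product, Finset.card_univ] at h
  rw [avoidCount, h, avoidCount]
  congr 1
  · rw [← Finset.card_image_of_injective _ hinj']
    congr 1
    ext v
    simp only [Finset.mem_image, Finset.mem_filter, Finset.mem_product, Finset.mem_univ, true_and,
      mem_wordsWith, Prod.exists]
    constructor
    · rintro ⟨c, u, ⟨⟨h1, -⟩, h3⟩, rfl⟩
      exact ⟨by simp [h1], h3⟩
    · rintro ⟨h1, h2⟩
      obtain ⟨u, c, h3, rfl⟩ := hsurj v h1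
      exact ⟨c, u, ⟨⟨h3, h2.of_infix (List.prefix_append _ _).isInfix⟩, h2⟩, rfl⟩
  · refine Finset.sum_congr rfl fun j _ => ?_
    rw [← Finset.card_image_of_injective _ hinj', firstHitCount]
    congr 1
    ext v
    simp only [Finset.mem_image, Finset.mem_filter, Finset.mem_product, Finset.mem_univ, true_and,
      mem_wordsWith, Prod.exists]
    constructor
    · rintro ⟨c, u, ⟨⟨h1, h2⟩, h3⟩, rfl⟩
      exact ⟨by simp [h1], by simpa using h2, h3⟩
    · rintro ⟨h1, h2, h3⟩
      obtain ⟨u, c, h4, rfl⟩ := hsurj v h1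
      exact ⟨c, u, ⟨⟨h4, by simpa using h2⟩, h3⟩, rfl⟩

theorem card_avoids_append_take [Fintype ι] {w : ι → List A} {n : ℕ}
    (hlen : ∀ j, (w j).length = n) (hinj : Function.Injective w) (i : ι) (m : ℕ) {t : ℕ}
    (ht : t < n) :
    (wordsWith (fun u => Avoids w (u ++ (w i).take t)) m).card =
      (wordsWith (fun u => Avoids w (u ++ (w i).take (t + 1))) m).card +
        ∑ j, ∑ r ∈ corrFinset (w j) (w i) with r = t, firstHitCount w j (m + r) := by
  classical
  have hw : (w i).take (t + 1) = (w i).take t ++ [(w i)[t]'(by rw [hlen]; exact ht)] := by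
    simp
  have hl : ((w i).take (t + 1)).length = t + 1 := by
    rw [List.length_take, hlen]; omega
  rw [card_eq_card_avoids_add_sum hlen hinj _ (fun u => u ++ (w i).take (t + 1))]
  · congr 1
    · congr 1
      ext u
      simp only [Finset.mem_filter, mem_wordsWith, and_assoc]
      refine and_congr_right fun _ => and_iff_right_of_imp fun h => h.of_infix ?_
      rw [hw, ← List.append_assoc]
      exact (List.prefix_append _ _).isInfix
    · refine Finset.sum_congr rfl fun j _ => ?_
      by_cases hc : corrIdx (w j) (w i) t
      · have : (corrFinset (w j) (w i)).filter (· = t) = {t} := by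
          ext r
          simp only [corrFinset, Finset.mem_filter, Finset.mem_range, Finset.mem_singleton, hlen]
          constructor
          · exact fun h => h.2
          · rintro rfl
            exact ⟨⟨ht, hc⟩, rfl⟩
        rw [this, Finset.sum_singleton, firstHitCount,
          ← Finset.card_image_of_injective _ (List.append_left_injective ((w i).take (t + 1)))]
        congr 1
        ext v
        simp only [Finset.mem_image, Finset.mem_filter, mem_wordsWith]
        constructor
        · rintro ⟨u, ⟨⟨h1, h2⟩, h3⟩, rfl⟩
          refine ⟨by rw [List.length_append, hl, h1]; rfl, ?_, h3⟩
          rw [hw, ← List.append_assoc, List.dropLast_concat]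
          exact h2
        · rintro ⟨h1, h2, h3⟩
          obtain ⟨u, rfl⟩ := ((corrIdx_iff (by simp [hlen]) t).1 hc).2.trans h3
          refine ⟨u, ⟨⟨?_, ?_⟩, h3⟩, rfl⟩
          · rw [List.length_append, hl] at h1
            omega
          · rwa [hw, ← List.append_assoc, List.dropLast_concat] at h2
      · rw [Finset.sum_eq_zero, Finset.card_eq_zero, Finset.filter_eq_empty_iff]
        · intro u _ h
          refine hc ((corrIdx_iff (by simp [hlen]) t).2 ⟨by rw [hlen]; exact ht, ?_⟩)
          exact List.suffix_of_suffix_length_le (List.suffix_append _ _) h (by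
            rw [hl, hlen]; omega)
        · intro r hr
          simp only [corrFinset, Finset.mem_filter] at hr
          exact absurd (hr.2 ▸ hr.1.2) hc
  · intro u hu
    rw [hw, ← List.append_assoc, List.dropLast_concat]
    exact ⟨List.append_ne_nil_of_right_ne_nil _ (by simp), (mem_wordsWith.1 hu).2⟩

theorem avoidCount_eq_sum_firstHitCount [Fintype ι] {w : ι → List A} {n : ℕ}
    (hlen : ∀ j, (w j).length = n) (hinj : Function.Injective w) (i : ι) (m : ℕ) :
    avoidCount w m = ∑ j, ∑ r ∈ corrFinset (w j) (w i), firstHitCount w j (m + r) := by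
  classical
  have key : ∀ t ≤ n, avoidCount w m =
      (wordsWith (fun u => Avoids w (u ++ (w i).take t)) m).card +
        ∑ j, ∑ r ∈ corrFinset (w j) (w i) with r < t, firstHitCount w j (m + r) := by
    intro t
    induction t with
    | zero => simp [avoidCount]
    | succ t ih =>
      intro ht
      rw [ih (by omega), card_avoids_append_take hlen hinj i m (by omega), add_assoc,
        ← Finset.sum_add_distrib]
      congr 1
      refine Finset.sum_congr rfl fun j _ => ?_
      rw [← Finset.sum_union]
      · refine Finset.sum_congr ?_ fun _ _ => rfl
        ext r
        simp only [Finset.mem_union, Finset.mem_filter]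
        grind
      · exact Finset.disjoint_filter.2 fun r _ h => by omega
  rw [key n le_rfl]
  have h0 : wordsWith (fun u => Avoids w (u ++ (w i).take n)) m = ∅ := by
    rw [Finset.eq_empty_iff_forall_notMem]
    intro u hu
    refine (mem_wordsWith.1 hu).2 i ?_
    rw [← hlen i, List.take_length]
    exact (List.suffix_append _ _).isInfix
  rw [h0, Finset.card_empty, zero_add]
  refine Finset.sum_congr rfl fun j _ => ?_
  rw [Finset.filter_true_of_mem]
  intro r hr
  exact hlen j ▸ lt_length_of_mem_corrFinset hr

theorem firstHitCount_add_le_avoidCount [Fintype ι] {w : ι → List A} {n : ℕ}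
    (hlen : ∀ j, (w j).length = n + 1) (hinj : Function.Injective w) (i : ι) (m : ℕ) :
    firstHitCount w i (m + n) ≤ avoidCount w m := by
  rw [avoidCount_eq_sum_firstHitCount hlen hinj i m]
  have hmem : n ∈ corrFinset (w i) (w i) := by
    simp only [corrFinset, Finset.mem_filter, Finset.mem_range, hlen]
    refine ⟨by omega, (corrIdx_iff rfl n).2 ⟨by rw [hlen]; omega, ?_⟩⟩
    rw [List.take_of_length_le (hlen i).le]
  exact (Finset.single_le_sum (f := fun r => firstHitCount w i (m + r))
    (fun _ _ => Nat.zero_le _) hmem).trans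
    (Finset.single_le_sum
      (f := fun j => ∑ r ∈ corrFinset (w j) (w i), firstHitCount w j (m + r))
      (fun _ _ => Nat.zero_le _) (Finset.mem_univ i))

theorem avoidCount_add_le (w : ι → List A) (m l : ℕ) :
    avoidCount w (m + l) ≤ avoidCount w m * avoidCount w l := by
  rw [avoidCount, avoidCount, avoidCount, ← Finset.card_product]
  refine Finset.card_le_card_of_injOn (fun v => (v.take m, v.drop m)) ?_ ?_
  · intro v hv
    obtain ⟨h1, h2⟩ := mem_wordsWith.1 hv
    refine Finset.mem_product.2 ⟨mem_wordsWith.2 ⟨?_, ?_⟩, mem_wordsWith.2 ⟨?_, ?_⟩⟩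
    · simp [h1]
    · exact h2.of_infix (List.take_prefix _ _).isInfix
    · simp [h1]
    · exact h2.of_infix (List.drop_suffix _ _).isInfix
  · intro u _ v _ h
    simp only [Prod.mk.injEq] at h
    rw [← List.take_append_drop m u, ← List.take_append_drop m v, h.1, h.2]

end AvoidingWords

section Extension

theorem occursIn_of_infix {A : Type*} {u v : List A} {y : ℤ → A} (huv : u <:+: v)
    (hv : occursIn v y) : occursIn u y := by
  obtain ⟨s, t, rfl⟩ := huv
  obtain ⟨i, hi⟩ := hv
  refine ⟨i + s.length, fun k => ?_⟩
  have := hi ⟨s.length + k, by simp; omega⟩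
  push_cast at this
  rw [add_assoc, this]
  simp

variable {A ι : Type*} [Nontrivial A] {w : ι → List A} {n : ℕ}

theorem exists_avoids_concat (hn : 2 ≤ n) (hlen : ∀ j, (w j).length = n)
    (hhead : Function.Injective fun j => (w j).head?) {u : List A} (hu : Avoids w u) :
    ∃ c, Avoids w (u ++ [c]) := by
  by_contra! hcon
  obtain ⟨a, b, hab⟩ := exists_pair_ne A
  have key : ∀ c, ∃ j t, w j = t ++ [c] ∧ t <:+ u := by
    intro c
    obtain ⟨j, hj⟩ := (not_avoids_concat_iff hu c).1 (hcon c)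
    rcases List.suffix_concat_iff.1 hj with h | ⟨t, h1, h2⟩
    · have := hlen j
      simp [h] at this
      omega
    · exact ⟨j, t, h1, h2⟩
  obtain ⟨i, s, hi, hs⟩ := key a
  obtain ⟨j, t, hj, ht⟩ := key b
  have hls := hlen i
  have hlt := hlen j
  rw [hi, List.length_append, List.length_singleton] at hls
  rw [hj, List.length_append, List.length_singleton] at hlt
  have hst : s = t :=
    (List.suffix_of_suffix_length_le hs ht (by omega)).eq_of_length (by omega)
  subst hst
  have hne : s ≠ [] := by rintro rfl; simp at hls; omega
  have hij : i = j := hhead (by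
    simp only [hi, hj, List.head?_append_of_ne_nil _ hne])
  subst hij
  rw [hi] at hj
  exact hab (by simpa using hj)

theorem exists_avoids_cons_cons (hn : 2 ≤ n) (hlen : ∀ j, (w j).length = n)
    (hhead : Function.Injective fun j => (w j).head?) {v : List A} {c : A}
    (hcv : Avoids w (c :: v)) : ∃ d e, Avoids w (e :: d :: v) := by
  by_contra! hcon
  have key : ∀ {u : List A} (e : A), Avoids w u → ¬ Avoids w (e :: u) →
      ∃ j t, w j = e :: t ∧ t <+: u ∧ t.length + 1 = n := by
    intro u e hu hne
    obtain ⟨j, hj⟩ := (not_avoids_cons_iff hu e).1 hne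
    rcases List.prefix_cons_iff.1 hj with h | ⟨t, h1, h2⟩
    · have := hlen j
      simp [h] at this
      omega
    · exact ⟨j, t, h1, h2, by rw [← hlen j, h1, List.length_cons]⟩
  have hv : Avoids w v := hcv.of_infix (List.suffix_cons c v).isInfix
  obtain ⟨d, hd⟩ := exists_ne c
  obtain ⟨j, p, hj, hp, hpl⟩ := key d hcv (hcon c d)
  have hdv : Avoids w (d :: v) := by
    by_contra hdv
    obtain ⟨i, q, hi, hq, hql⟩ := key d hv hdv
    have hij : i = j := hhead (by simp [hi, hj])
    subst hij
    obtain rfl : p = q := by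
      rw [hi] at hj
      exact (List.cons.inj hj).2.symm
    obtain ⟨l, r, hl, hr, hrl⟩ := key c hcv (hcon c c)
    obtain rfl : r = p :=
      (List.prefix_of_prefix_length_le hr hp (by omega)).eq_of_length (by omega)
    exact hcv l (hl ▸ (List.cons_prefix_cons.2 ⟨rfl, hq⟩).isInfix)
  obtain ⟨i, q, hi, hq, hql⟩ := key d hdv (hcon d d)
  have hij : i = j := hhead (by simp [hi, hj])
  subst hij
  obtain rfl : p = q := by
    rw [hi] at hj
    exact (List.cons.inj hj).2.symm
  cases p with
  | nil => simp at hpl; omega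
  | cons a p =>
    exact hd ((List.cons_prefix_cons.1 hq).1.symm.trans (List.cons_prefix_cons.1 hp).1)

/-- A word that can be prolonged to the left by one letter while avoiding the `w j` occurs in a
bi-infinite sequence avoiding the `w j`. -/
theorem exists_occursIn_of_avoids_cons (hn : 2 ≤ n) (hlen : ∀ j, (w j).length = n)
    (hhead : Function.Injective fun j => (w j).head?) {u : List A} {c : A}
    (hu : Avoids w (c :: u)) :
    ∃ y : ℤ → A, (∀ j, ¬ occursIn (w j) y) ∧ occursIn u y := by
  let S := {v : List A // ∃ c, Avoids w (c :: v)}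
  have hstep : ∀ v : S, ∃ v' : S, ∃ d e, v'.1 = d :: (v.1 ++ [e]) := by
    rintro ⟨v, c, hv⟩
    obtain ⟨d, e, hde⟩ := exists_avoids_cons_cons hn hlen hhead hv
    obtain ⟨f, hf⟩ := exists_avoids_concat hn hlen hhead hde
    exact ⟨⟨d :: (v ++ [f]), e, hf⟩, d, f, rfl⟩
  choose next left right hnext using hstep
  let s : ℕ → S := fun t => next^[t] ⟨u, c, hu⟩
  have hs : ∀ t, (s (t + 1)).1 = left (s t) :: ((s t).1 ++ [right (s t)]) := by
    intro t
    rw [← hnext]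
    simp only [s, Function.iterate_succ_apply']
  have hlen' : ∀ t, (s t).1.length = u.length + 2 * t := by
    intro t
    induction t with
    | zero => rfl
    | succ t ih =>
      rw [hs, List.length_cons, List.length_append, ih, List.length_singleton]
      omega
  have hshift : ∀ r t a, a < u.length + 2 * t → (s (t + r)).1[a + r]? = (s t).1[a]? := by
    intro r
    induction r with
    | zero => intros; rfl
    | succ r ih =>
      intro t a ha
      rw [← add_assoc, ← add_assoc, hs, List.getElem?_cons_succ,
        List.getElem?_append_left (by rw [hlen']; omega), ih t a ha]
  have hidx : ∀ i : ℤ, (i + (i.natAbs + 1)).toNat < (s (i.natAbs + 1)).1.length := by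
    intro i
    rw [hlen']
    omega
  let y : ℤ → A := fun i => (s (i.natAbs + 1)).1[(i + (i.natAbs + 1)).toNat]'(hidx i)
  have hy : ∀ (i : ℤ) (t : ℕ), i.natAbs + 1 ≤ t → (s t).1[(i + t).toNat]? = some (y i) := by
    intro i t ht
    obtain ⟨r, rfl⟩ := Nat.exists_eq_add_of_le ht
    have h1 := hidx i
    rw [hlen'] at h1
    have := hshift r (i.natAbs + 1) _ h1
    rw [List.getElem?_eq_getElem (hidx i)] at this
    rw [← this]
    congr 1
    omega
  refine ⟨y, ?_, 0, ?_⟩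
  · rintro j ⟨i, hi⟩
    obtain ⟨c, hc⟩ := (s (i.natAbs + (w j).length + 1)).2
    refine hc j (List.IsInfix.trans ?_ (List.suffix_cons c _).isInfix)
    refine List.infix_iff_getElem?.2 ⟨(i + (i.natAbs + (w j).length + 1 : ℕ)).toNat, ?_, ?_⟩
    · rw [hlen']
      omega
    · intro k hk
      have := hy (i + k) (i.natAbs + (w j).length + 1) (by omega)
      rw [hi ⟨k, hk⟩] at this
      rw [List.get_eq_getElem] at this
      rw [← this]
      congr 1
      omega
  · intro k
    have h1 := hy (0 + (k : ℕ)) (k + 1) (by omega)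
    have h2 := hshift (k + 1) 0 k (by omega)
    rw [zero_add (k + 1 : ℕ)] at h2
    have h3 : ((0 + ((k : ℕ) : ℤ)) + ((k : ℕ) + 1 : ℕ)).toNat = k + (k + 1) := by omega
    rw [h3, h2] at h1
    have h4 : (s 0).1 = u := rfl
    rw [h4, List.getElem?_eq_getElem k.2] at h1
    exact (Option.some.inj h1).symm

end Extension

section Entropy

theorem bddBelow_log_natCast_div (f : ℕ → ℕ) :
    BddBelow (Set.range fun m : ℕ => Real.log (f m) / m) := by
  refine ⟨0, ?_⟩
  rintro _ ⟨m, rfl⟩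
  exact div_nonneg (Real.log_natCast_nonneg _) (Nat.cast_nonneg _)

variable {A ι : Type*} [Fintype A] {w : ι → List A} {n : ℕ}

theorem langN_perturbFamily_subset (w : ι → List A) (m : ℕ) :
    langN (perturbFamily Set.univ {v | ∃ i, v = w i}) m ⊆ wordsWith (Avoids w) m := by
  rintro v ⟨⟨y, ⟨-, hy⟩, hv⟩, hm⟩
  simp only [Finset.mem_coe, mem_wordsWith]
  exact ⟨hm, fun j hj => hy _ ⟨j, rfl⟩ (occursIn_of_infix hj hv)⟩

theorem ncard_langN_le_avoidCount (w : ι → List A) (m : ℕ) :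
    (langN (perturbFamily Set.univ {v | ∃ i, v = w i}) m).ncard ≤ avoidCount w m := by
  rw [avoidCount, ← Set.ncard_coe_finset]
  exact Set.ncard_le_ncard (langN_perturbFamily_subset w m) (Finset.finite_toSet _)

theorem subadditive_log_avoidCount (h : ∀ m, 0 < avoidCount w m) :
    Subadditive fun m => Real.log (avoidCount w m) := by
  intro m l
  have h1 : (avoidCount w m : ℝ) ≠ 0 := by exact_mod_cast (h m).ne'
  have h2 : (avoidCount w l : ℝ) ≠ 0 := by exact_mod_cast (h l).ne'
  rw [← Real.log_mul h1 h2]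
  exact Real.log_le_log (by exact_mod_cast h _) (by exact_mod_cast avoidCount_add_le w m l)

variable [Nontrivial A]

theorem avoidCount_pos (hn : 2 ≤ n) (hlen : ∀ j, (w j).length = n)
    (hhead : Function.Injective fun j => (w j).head?) (m : ℕ) : 0 < avoidCount w m := by
  induction m with
  | zero => simp [avoidCount_zero (by omega) hlen]
  | succ m ih =>
    obtain ⟨u, hu⟩ := Finset.card_pos.1 ih
    obtain ⟨h1, h2⟩ := mem_wordsWith.1 hu
    obtain ⟨c, hc⟩ := exists_avoids_concat hn hlen hhead h2
    exact Finset.card_pos.2 ⟨u ++ [c], mem_wordsWith.2 ⟨by simp [h1], hc⟩⟩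

theorem avoidCount_succ_le_card_mul (hn : 2 ≤ n) (hlen : ∀ j, (w j).length = n)
    (hhead : Function.Injective fun j => (w j).head?) (m : ℕ) :
    avoidCount w (m + 1) ≤
      Fintype.card A * (langN (perturbFamily Set.univ {v | ∃ i, v = w i}) m).ncard := by
  set L := langN (perturbFamily Set.univ {v | ∃ i, v = w i}) m with hL
  have hfin : L.Finite := (Finset.finite_toSet _).subset (langN_perturbFamily_subset w m)
  have hsub : (wordsWith (Avoids w) (m + 1) : Set (List A)) ⊆
      (fun p : A × List A => p.1 :: p.2) '' (Set.univ ×ˢ L) := by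
    intro v hv
    obtain ⟨h1, h2⟩ := mem_wordsWith.1 (Finset.mem_coe.1 hv)
    cases v with
    | nil => simp at h1
    | cons c u =>
      obtain ⟨y, hy, hu⟩ := exists_occursIn_of_avoids_cons hn hlen hhead h2
      refine ⟨(c, u), ⟨Set.mem_univ _, ⟨y, ⟨Set.mem_univ _, ?_⟩, hu⟩, ?_⟩, rfl⟩
      · rintro _ ⟨j, rfl⟩
        exact hy j
      · simpa using h1
  have hfin' : ((Set.univ : Set A) ×ˢ L).Finite := Set.finite_univ.prod hfin
  calc avoidCount w (m + 1) = (wordsWith (Avoids w) (m + 1) : Set (List A)).ncard := by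
        rw [Set.ncard_coe_finset, avoidCount]
    _ ≤ _ := Set.ncard_le_ncard hsub (hfin'.image _)
    _ ≤ _ := Set.ncard_image_le hfin'
    _ = _ := by rw [Set.ncard_prod, Set.ncard_univ, Nat.card_eq_fintype_card]

theorem entropy_perturbFamily_eq_lim (hn : 2 ≤ n) (hlen : ∀ j, (w j).length = n)
    (hhead : Function.Injective fun j => (w j).head?) :
    entropy (perturbFamily Set.univ {v | ∃ i, v = w i}) =
      (subadditive_log_avoidCount (avoidCount_pos hn hlen hhead)).lim := by
  set hsub := subadditive_log_avoidCount (avoidCount_pos hn hlen hhead)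
  set L := langN (perturbFamily Set.univ {v | ∃ i, v = w i})
  have hpos := avoidCount_pos hn hlen hhead
  have hlim := hsub.tendsto_lim (bddBelow_log_natCast_div (avoidCount w))
  have hcard : (0 : ℝ) < Fintype.card A := by exact_mod_cast Fintype.card_pos
  have hLpos : ∀ m, (0 : ℝ) < (L m).ncard := by
    intro m
    have := (hpos (m + 1)).trans_le (avoidCount_succ_le_card_mul hn hlen hhead m)
    exact_mod_cast Nat.pos_of_mul_pos_left this
  have hlow : Tendsto (fun m : ℕ => Real.log (avoidCount w (m + 1)) / (m + 1 : ℕ) *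
      ((m + 1 : ℕ) / m) - Real.log (Fintype.card A) / m) atTop (𝓝 (hsub.lim * 1 - 0)) := by
    refine Tendsto.sub (Tendsto.mul (hlim.comp (tendsto_add_atTop_nat 1)) ?_)
      (tendsto_const_div_atTop_nhds_zero_nat _)
    have h1 : Tendsto (fun m : ℕ => 1 + 1 / (m : ℝ)) atTop (𝓝 (1 + 0)) :=
      tendsto_const_nhds.add (tendsto_const_div_atTop_nhds_zero_nat 1)
    rw [add_zero] at h1
    refine h1.congr' ?_
    filter_upwards [eventually_ne_atTop 0] with m hm
    have : (m : ℝ) ≠ 0 := by exact_mod_cast hm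
    push_cast
    field_simp
  rw [mul_one, sub_zero] at hlow
  refine Tendsto.limsup_eq (tendsto_of_tendsto_of_tendsto_of_le_of_le' hlow hlim ?_ ?_)
  · filter_upwards [eventually_ne_atTop 0] with m hm
    have hm' : (m : ℝ) ≠ 0 := by exact_mod_cast hm
    rw [div_mul_div_cancel₀ (by positivity), ← sub_div]
    refine div_le_div_of_nonneg_right ?_ (Nat.cast_nonneg _)
    rw [sub_le_iff_le_add', ← Real.log_mul hcard.ne' (hLpos m).ne']
    exact Real.log_le_log (by exact_mod_cast hpos _)
      (by exact_mod_cast avoidCount_succ_le_card_mul hn hlen hhead m)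
  · filter_upwards with m
    exact div_le_div_of_nonneg_right (Real.log_le_log (hLpos m)
      (by exact_mod_cast ncard_langN_le_avoidCount w m)) (Nat.cast_nonneg _)

theorem pow_le_avoidCount {lam : ℝ} (hlampos : 0 < lam)
    (hlam : entropy (perturbFamily Set.univ {v | ∃ i, v = w i}) = Real.log lam)
    (hn : 2 ≤ n) (hlen : ∀ j, (w j).length = n)
    (hhead : Function.Injective fun j => (w j).head?) (m : ℕ) : lam ^ m ≤ avoidCount w m := by
  rcases Nat.eq_zero_or_pos m with rfl | hm
  · simp [avoidCount_zero (by omega) hlen]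
  have hpos := avoidCount_pos hn hlen hhead
  have h := (subadditive_log_avoidCount hpos).lim_le_div
    (bddBelow_log_natCast_div (avoidCount w)) hm.ne'
  rw [← entropy_perturbFamily_eq_lim hn hlen hhead, hlam,
    le_div_iff₀ (by exact_mod_cast hm), mul_comm, ← Real.log_pow] at h
  exact (Real.log_le_log_iff (pow_pos hlampos m) (by exact_mod_cast hpos m)).1 h

theorem summable_avoidCount_div_pow {lam : ℝ} (hlampos : 0 < lam)
    (hlam : entropy (perturbFamily Set.univ {v | ∃ i, v = w i}) = Real.log lam)
    (hn : 2 ≤ n) (hlen : ∀ j, (w j).length = n)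
    (hhead : Function.Injective fun j => (w j).head?) {z : ℝ} (hz : lam < z) :
    Summable fun m => (avoidCount w m : ℝ) / z ^ m := by
  have hpos := avoidCount_pos hn hlen hhead
  obtain ⟨r, hr1, hr2⟩ := exists_between hz
  have hr0 : 0 < r := hlampos.trans hr1
  have hz0 : 0 < z := hr0.trans hr2
  have h := (subadditive_log_avoidCount hpos).tendsto_lim
    (bddBelow_log_natCast_div (avoidCount w))
  rw [← entropy_perturbFamily_eq_lim hn hlen hhead, hlam] at h
  have hev : ∀ᶠ m : ℕ in atTop, ‖(avoidCount w m : ℝ) / z ^ m‖ ≤ (r / z) ^ m := by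
    filter_upwards [h.eventually_lt_const (Real.log_lt_log hlampos hr1), eventually_gt_atTop 0]
      with m hm hm0
    rw [div_lt_iff₀ (by exact_mod_cast hm0), mul_comm, ← Real.log_pow] at hm
    have := (Real.log_lt_log_iff (by exact_mod_cast hpos m) (pow_pos hr0 m)).1 hm
    rw [Real.norm_of_nonneg (by positivity), div_pow]
    gcongr
  exact Summable.of_norm_bounded_eventually_nat
    (summable_geometric_of_lt_one (by positivity) ((div_lt_one hz0).2 hr2)) hev

end Entropy

section InverseSum

variable {ι : Type*} [Fintype ι] [DecidableEq ι]

theorem sum_eq_mul_sum_inv_of_mulVec_eq_const {M : Matrix ι ι ℝ} (hM : IsUnit M.det)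
    {v : ι → ℝ} {c : ℝ} (h : M.mulVec v = fun _ => c) :
    ∑ i, v i = (∑ i, ∑ j, M⁻¹ i j) * c := by
  have hv : v = M⁻¹.mulVec (fun _ => c) := by
    rw [← h, Matrix.mulVec_mulVec, Matrix.nonsing_inv_mul M hM, Matrix.one_mulVec]
  conv_lhs => rw [hv]
  simp [Matrix.mulVec, dotProduct, Finset.sum_mul]

theorem tendsto_sum_inv {β : Type*} {l : Filter β} {M : β → Matrix ι ι ℝ} {B : Matrix ι ι ℝ}
    (hM : Tendsto M l (𝓝 B)) (hB : IsUnit B.det) :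
    Tendsto (fun b => ∑ i, ∑ j, (M b)⁻¹ i j) l (𝓝 (∑ i, ∑ j, B⁻¹ i j)) := by
  have hinv : Tendsto (fun b => (M b)⁻¹) l (𝓝 B⁻¹) := by
    refine (continuousAt_matrix_inv B ?_).tendsto.comp hM
    rw [Ring.inverse_eq_inv']
    exact continuousAt_inv₀ hB.ne_zero
  exact tendsto_finsetSum _ fun i _ => tendsto_finsetSum _ fun j _ =>
    (tendsto_pi_nhds.1 (tendsto_pi_nhds.1 hinv i) j)

theorem sum_inv_smul {M : Matrix ι ι ℝ} (hM : IsUnit M.det) {c : ℝ} (hc : c ≠ 0) :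
    ∑ i, ∑ j, (c • M)⁻¹ i j = c⁻¹ * ∑ i, ∑ j, M⁻¹ i j := by
  have : (c • M)⁻¹ = c⁻¹ • M⁻¹ := Matrix.inv_smul' M (Units.mk0 c hc) hM
  simp [this, Finset.mul_sum]

theorem isUnit_det_smul_iff {M : Matrix ι ι ℝ} {c : ℝ} (hc : c ≠ 0) :
    IsUnit (c • M).det ↔ IsUnit M.det := by
  simp [hc]

end InverseSum

section GeneratingFunction

variable {A ι : Type*}

/-- The matrix of correlation polynomials of a family of words. -/
noncomputable def corrPolyMatrix (w : ι → List A) (z : ℝ) : Matrix ι ι ℝ :=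
  Matrix.of fun i j => corrPoly (w j) (w i) z

theorem continuous_corrPolyMatrix (w : ι → List A) : Continuous (corrPolyMatrix w) := by
  refine continuous_pi fun i => continuous_pi fun j => ?_
  simp only [corrPolyMatrix, Matrix.of_apply, corrPoly]
  fun_prop

variable [Fintype A] [Fintype ι] {w : ι → List A} {n : ℕ}

theorem firstHitCount_le (hlen : ∀ j, (w j).length = n)
    (hinj : Function.Injective w) (j : ι) (m : ℕ) :
    firstHitCount w j m ≤ Fintype.card A * avoidCount w m := by
  rw [card_mul_avoidCount hlen hinj]
  exact (Finset.single_le_sum (f := fun j => firstHitCount w j m)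
    (fun _ _ => Nat.zero_le _) (Finset.mem_univ j)).trans (Nat.le_add_left _ _)

variable {z : ℝ}

theorem summable_firstHitCount_div_pow (hlen : ∀ j, (w j).length = n)
    (hinj : Function.Injective w) (hz : 0 < z)
    (hsum : Summable fun m => (avoidCount w m : ℝ) / z ^ m) (j : ι) :
    Summable fun m => (firstHitCount w j m : ℝ) / z ^ m := by
  refine Summable.of_nonneg_of_le (fun m => by positivity) (fun m => ?_)
    (hsum.mul_left (Fintype.card A : ℝ))
  rw [← mul_div_assoc]
  gcongr
  exact_mod_cast firstHitCount_le hlen hinj j m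

theorem card_mul_tsum_avoidCount (hn : 0 < n) (hlen : ∀ j, (w j).length = n)
    (hinj : Function.Injective w) (hz : 0 < z)
    (hsum : Summable fun m => (avoidCount w m : ℝ) / z ^ m) :
    Fintype.card A * ∑' m, (avoidCount w m : ℝ) / z ^ m =
      z * (∑' m, (avoidCount w m : ℝ) / z ^ m - 1) +
        ∑ j, ∑' m, (firstHitCount w j m : ℝ) / z ^ m := by
  have h1 : HasSum (fun m => z * ((avoidCount w (m + 1) : ℝ) / z ^ (m + 1)))
      (z * (∑' m, (avoidCount w m : ℝ) / z ^ m - 1)) := by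
    have := ((hasSum_nat_add_iff' 1).2 hsum.hasSum).mul_left z
    simpa [avoidCount_zero hn hlen] using this
  have h2 := h1.add (hasSum_sum (s := Finset.univ) fun j _ =>
    (summable_firstHitCount_div_pow hlen hinj hz hsum j).hasSum)
  refine (hsum.hasSum.mul_left _).unique (h2.congr_fun fun m => ?_)
  have := congrArg (Nat.cast (R := ℝ)) (card_mul_avoidCount hlen hinj m)
  push_cast at this
  rw [← Finset.sum_div, ← mul_div_assoc, this, pow_succ]
  field_simp

theorem corrPolyMatrix_mulVec_tsum (hlen : ∀ j, (w j).length = n)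
    (hinj : Function.Injective w) (hz : 0 < z)
    (hsum : Summable fun m => (avoidCount w m : ℝ) / z ^ m) :
    (corrPolyMatrix w z).mulVec (fun j => ∑' m, (firstHitCount w j m : ℝ) / z ^ m) =
      fun _ => ∑' m, (avoidCount w m : ℝ) / z ^ m := by
  funext i
  simp only [Matrix.mulVec, dotProduct, corrPolyMatrix, Matrix.of_apply, corrPoly, Finset.sum_mul]
  have h : ∀ j, ∀ r ∈ corrFinset (w j) (w i),
      HasSum (fun m => (firstHitCount w j (m + r) : ℝ) / z ^ m)
        (z ^ r * ∑' m, (firstHitCount w j m : ℝ) / z ^ m) := by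
    intro j r hr
    have hr' : r < n := hlen j ▸ lt_length_of_mem_corrFinset hr
    have := ((hasSum_nat_add_iff' r).2
      (summable_firstHitCount_div_pow hlen hinj hz hsum j).hasSum).mul_left (z ^ r)
    rw [Finset.sum_eq_zero, sub_zero] at this
    · refine this.congr_fun fun m => ?_
      rw [pow_add]
      field_simp
    · intro m hm
      rw [firstHitCount_eq_zero hlen j (by have := Finset.mem_range.1 hm; omega)]
      simp
  have h2 := hasSum_sum (s := Finset.univ) fun j _ => hasSum_sum (h j)
  refine h2.unique (hsum.hasSum.congr_fun fun m => ?_)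
  rw [avoidCount_eq_sum_firstHitCount hlen hinj i m]
  push_cast
  simp only [Finset.sum_div]

/-- The generating function of the number of words avoiding a family of words. -/
theorem tsum_avoidCount_mul [DecidableEq ι] (hn : 0 < n) (hlen : ∀ j, (w j).length = n)
    (hinj : Function.Injective w) (hz : 0 < z)
    (hsum : Summable fun m => (avoidCount w m : ℝ) / z ^ m)
    (hdet : IsUnit (corrPolyMatrix w z).det) :
    (∑' m, (avoidCount w m : ℝ) / z ^ m) *
      (z - Fintype.card A + ∑ i, ∑ j, (corrPolyMatrix w z)⁻¹ i j) = z := by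
  have h1 := card_mul_tsum_avoidCount hn hlen hinj hz hsum
  rw [sum_eq_mul_sum_inv_of_mulVec_eq_const hdet
    (corrPolyMatrix_mulVec_tsum hlen hinj hz hsum)] at h1
  linear_combination -h1

theorem mul_avoidCount_le_avoidCount_succ (hlen : ∀ j, (w j).length = n + 1)
    (hinj : Function.Injective w) {r : ℝ} (hr : 0 < r)
    (hr' : Fintype.card ι ≤ (Fintype.card A - r) * r ^ n) (m : ℕ) :
    r * avoidCount w m ≤ avoidCount w (m + 1) := by
  induction m using Nat.strong_induction_on with
  | _ m ih =>
  have hgap : 0 ≤ Fintype.card A - r :=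
    nonneg_of_mul_nonneg_left ((Nat.cast_nonneg _).trans hr') (pow_pos hr n)
  have hpow : ∀ l p, p + l ≤ m → r ^ l * avoidCount w p ≤ avoidCount w (p + l) := by
    intro l p
    induction l with
    | zero => simp
    | succ l ihl =>
      intro h
      have h1 := ihl (by omega)
      have h2 := ih (p + l) (by omega)
      calc r ^ (l + 1) * (avoidCount w p : ℝ) = r * (r ^ l * avoidCount w p) := by ring
        _ ≤ r * avoidCount w (p + l) := by gcongr
        _ ≤ _ := h2
  have hhit : (∑ j, firstHitCount w j m : ℝ) ≤ (Fintype.card A - r) * avoidCount w m := by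
    rcases lt_or_ge m n with hm | hm
    · rw [Finset.sum_eq_zero]
      · positivity
      · intro j _
        rw [firstHitCount_eq_zero hlen j (by omega), Nat.cast_zero]
    · obtain ⟨p, rfl⟩ := Nat.exists_eq_add_of_le' hm
      calc (∑ j, firstHitCount w j (p + n) : ℝ) ≤ ∑ _j : ι, (avoidCount w p : ℝ) :=
            Finset.sum_le_sum fun j _ => by
              exact_mod_cast firstHitCount_add_le_avoidCount hlen hinj j p
        _ = Fintype.card ι * avoidCount w p := by simp
        _ ≤ (Fintype.card A - r) * r ^ n * avoidCount w p := by gcongr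
        _ = (Fintype.card A - r) * (r ^ n * avoidCount w p) := by ring
        _ ≤ _ := by gcongr; exact hpow n p le_rfl
  have := congrArg (Nat.cast (R := ℝ)) (card_mul_avoidCount hlen hinj m)
  push_cast at this
  linarith

end GeneratingFunction

section GrowthRate

variable {A ι : Type*} [Fintype A] [Nontrivial A] [Fintype ι] {w : ι → List A} {n : ℕ} {lam : ℝ}

theorem sum_inv_corrPolyMatrix_mem_Ioc [DecidableEq ι] (hlampos : 0 < lam)
    (hlam : entropy (perturbFamily Set.univ {v | ∃ i, v = w i}) = Real.log lam)
    (hn : 2 ≤ n) (hlen : ∀ j, (w j).length = n)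
    (hhead : Function.Injective fun j => (w j).head?) {z : ℝ} (hz : lam < z)
    (hdet : IsUnit (corrPolyMatrix w z).det) :
    ∑ i, ∑ j, (corrPolyMatrix w z)⁻¹ i j ∈
      Set.Ioc (Fintype.card A - z) (Fintype.card A - lam) := by
  have hinj : Function.Injective w := Function.Injective.of_comp (f := List.head?) hhead
  have hz0 : 0 < z := hlampos.trans hz
  have hsum := summable_avoidCount_div_pow hlampos hlam hn hlen hhead hz
  have h := tsum_avoidCount_mul (by omega) hlen hinj hz0 hsum hdet
  have hgeom := hasSum_geometric_of_lt_one (r := lam / z) (by positivity) ((div_lt_one hz0).2 hz)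
  have hle : (1 - lam / z)⁻¹ ≤ ∑' m, (avoidCount w m : ℝ) / z ^ m := by
    refine hasSum_le (fun m => ?_) hgeom hsum.hasSum
    rw [div_pow]
    gcongr
    exact pow_le_avoidCount hlampos hlam hn hlen hhead m
  have hzl : 0 < z - lam := sub_pos.2 hz
  have heq : (1 - lam / z)⁻¹ = z / (z - lam) := by
    rw [one_sub_div hz0.ne', inv_div]
  rw [heq] at hle
  set F := ∑' m, (avoidCount w m : ℝ) / z ^ m
  set s := ∑ i, ∑ j, (corrPolyMatrix w z)⁻¹ i j
  have hF : 0 < F := (by positivity : 0 < z / (z - lam)).trans_le hle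
  have hs : 0 < z - Fintype.card A + s := by
    by_contra! hneg
    nlinarith
  refine ⟨by linarith, ?_⟩
  have := mul_le_mul_of_nonneg_right hle hs.le
  rw [h, div_mul_eq_mul_div, div_le_iff₀ hzl] at this
  have := le_of_mul_le_mul_left this hz0
  linarith

theorem sum_inv_corrPolyMatrix_eq [DecidableEq ι] (hlampos : 0 < lam)
    (hlam : entropy (perturbFamily Set.univ {v | ∃ i, v = w i}) = Real.log lam)
    (hn : 2 ≤ n) (hlen : ∀ j, (w j).length = n)
    (hhead : Function.Injective fun j => (w j).head?)
    (hdet : IsUnit (corrPolyMatrix w lam).det) :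
    ∑ i, ∑ j, (corrPolyMatrix w lam)⁻¹ i j = Fintype.card A - lam := by
  have hcont : Tendsto (corrPolyMatrix w) (𝓝[>] lam) (𝓝 (corrPolyMatrix w lam)) :=
    (continuous_corrPolyMatrix w).continuousAt.tendsto.mono_left nhdsWithin_le_nhds
  have hev : ∀ᶠ z in 𝓝[>] lam, IsUnit (corrPolyMatrix w z).det := by
    have := ((continuous_id.matrix_det).tendsto (corrPolyMatrix w lam)).comp hcont
    filter_upwards [this.eventually_ne hdet.ne_zero] with z hz
    exact isUnit_iff_ne_zero.2 hz
  have hid : Tendsto (fun z : ℝ => Fintype.card A - z) (𝓝[>] lam) (𝓝 (Fintype.card A - lam)) :=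
    (tendsto_const_nhds.sub tendsto_id).mono_left nhdsWithin_le_nhds
  refine tendsto_nhds_unique (tendsto_sum_inv hcont hdet)
    (tendsto_of_tendsto_of_tendsto_of_le_of_le' hid tendsto_const_nhds ?_ ?_)
  · filter_upwards [hev, self_mem_nhdsWithin] with z hz hlz
    exact (sum_inv_corrPolyMatrix_mem_Ioc hlampos hlam hn hlen hhead hlz hz).1.le
  · filter_upwards [hev, self_mem_nhdsWithin] with z hz hlz
    exact (sum_inv_corrPolyMatrix_mem_Ioc hlampos hlam hn hlen hhead hlz hz).2

theorem le_of_card_le_mul_pow (hlampos : 0 < lam)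
    (hlam : entropy (perturbFamily Set.univ {v | ∃ i, v = w i}) = Real.log lam)
    (hn : 1 ≤ n) (hlen : ∀ j, (w j).length = n + 1)
    (hhead : Function.Injective fun j => (w j).head?) {r : ℝ} (hr : 0 < r)
    (hr' : Fintype.card ι ≤ (Fintype.card A - r) * r ^ n) : r ≤ lam := by
  have hinj : Function.Injective w := Function.Injective.of_comp (f := List.head?) hhead
  by_contra! hlt
  have hsum := summable_avoidCount_div_pow hlampos hlam (by omega) hlen hhead hlt
  have hge : ∀ m, r ^ m ≤ avoidCount w m := by
    intro m
    induction m with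
    | zero => simp [avoidCount_zero (Nat.succ_pos n) hlen]
    | succ m ih =>
      calc r ^ (m + 1) = r * r ^ m := pow_succ' r m
        _ ≤ r * avoidCount w m := by gcongr
        _ ≤ _ := mul_avoidCount_le_avoidCount_succ hlen hinj hr hr' m
  have := (hsum.tendsto_atTop_zero.eventually_lt_const one_pos).exists
  obtain ⟨m, hm⟩ := this
  rw [div_lt_one (pow_pos hr m)] at hm
  exact (hge m).not_gt hm

theorem le_card_of_entropy_eq (hlampos : 0 < lam)
    (hlam : entropy (perturbFamily Set.univ {v | ∃ i, v = w i}) = Real.log lam)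
    (hn : 2 ≤ n) (hlen : ∀ j, (w j).length = n)
    (hhead : Function.Injective fun j => (w j).head?) : lam ≤ Fintype.card A := by
  have hinj : Function.Injective w := Function.Injective.of_comp (f := List.head?) hhead
  have h1 := pow_le_avoidCount hlampos hlam hn hlen hhead 1
  have h2 := card_mul_avoidCount hlen hinj 0
  rw [avoidCount_zero (by omega) hlen, mul_one] at h2
  rw [pow_one] at h1
  exact h1.trans (by exact_mod_cast h2 ▸ Nat.le_add_right _ _)

end GrowthRate

theorem abs_corrPoly_sub_le {A : Type*} (u v : List A) {a b c : ℝ} (hc : 1 ≤ c) (ha : |a| ≤ c)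
    (hb : |b| ≤ c) :
    |corrPoly u v a - corrPoly u v b| ≤ (u.length : ℝ) ^ 2 * |a - b| * c ^ u.length := by
  rw [corrPoly, corrPoly, ← Finset.sum_sub_distrib]
  have hcard : ((corrFinset u v).card : ℝ) ≤ u.length := by
    have h : corrFinset u v ⊆ Finset.range u.length := fun r hr =>
      Finset.mem_range.2 (lt_length_of_mem_corrFinset hr)
    exact_mod_cast (Finset.card_le_card h).trans_eq (Finset.card_range _)
  calc |∑ r ∈ corrFinset u v, (a ^ r - b ^ r)|
      ≤ ∑ r ∈ corrFinset u v, |a ^ r - b ^ r| := Finset.abs_sum_le_sum_abs _ _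
    _ ≤ ∑ _r ∈ corrFinset u v, |a - b| * u.length * c ^ u.length := by
        refine Finset.sum_le_sum fun r hr => ?_
        have hr' := lt_length_of_mem_corrFinset hr
        refine (abs_pow_sub_pow_le _ _ _).trans ?_
        gcongr
        calc max |a| |b| ^ (r - 1) ≤ c ^ (r - 1) := by gcongr; exact max_le ha hb
          _ ≤ c ^ u.length := pow_le_pow_right₀ hc (by omega)
    _ = (corrFinset u v).card * (|a - b| * u.length * c ^ u.length) := by simp
    _ ≤ u.length * (|a - b| * u.length * c ^ u.length) := by gcongr
    _ = _ := by ring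

theorem tendsto_smul_corrMatrix_of_tendsto {N k : ℕ} (hN : 1 ≤ N) {x : Fin k → ℕ → Fin N}
    {α : Matrix (Fin k) (Fin k) ℝ}
    (hα : ∀ i j, Tendsto (fun n => corrMatrix x n (N : ℝ) i j / (N : ℝ) ^ n) atTop (𝓝 (α i j)))
    {z : ℕ → ℝ} (hz : ∀ᶠ n in atTop, |z n| ≤ N)
    (hz' : Tendsto (fun n : ℕ => (n : ℝ) ^ 2 * |z n - N|) atTop (𝓝 0)) :
    Tendsto (fun n => ((N : ℝ) ^ n)⁻¹ • corrMatrix x n (z n)) atTop (𝓝 α) := by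
  refine tendsto_pi_nhds.2 fun i => tendsto_pi_nhds.2 fun j => ?_
  have hdiff : Tendsto (fun n => ((N : ℝ) ^ n)⁻¹ *
      (corrMatrix x n (z n) i j - corrMatrix x n N i j)) atTop (𝓝 0) := by
    refine squeeze_zero_norm' ?_ hz'
    filter_upwards [hz] with n hn
    have hpos : (0 : ℝ) < (N : ℝ) ^ n := by positivity
    rw [norm_mul, Real.norm_of_nonneg (inv_nonneg.2 hpos.le), inv_mul_le_iff₀ hpos,
      Real.norm_eq_abs]
    have := abs_corrPoly_sub_le (prefixWord (x j) n) (prefixWord (x i) n)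
      (c := (N : ℝ)) (by exact_mod_cast hN) hn (Nat.abs_cast N).le
    have hl : (prefixWord (x j) n).length = n := by simp [prefixWord]
    rw [hl] at this
    simpa [corrMatrix, mul_comm] using this
  have := (hα i j).add hdiff
  rw [add_zero] at this
  refine this.congr fun n => ?_
  simp only [Matrix.smul_apply, smul_eq_mul]
  ring

theorem tendsto_log_sub_log_mul {N S : ℝ} (hN : 0 < N) {lam c : ℕ → ℝ}
    (hlampos : ∀ n, 0 < lam n) (hlam : Tendsto lam atTop (𝓝 N)) (hc : ∀ n, 0 ≤ c n)
    (h : Tendsto (fun n => (N - lam n) * c n) atTop (𝓝 S)) :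
    Tendsto (fun n => (Real.log N - Real.log (lam n)) * c n) atTop (𝓝 (S / N)) := by
  refine tendsto_of_tendsto_of_tendsto_of_le_of_le (h.div_const N)
    (h.div hlam hN.ne') (fun n => ?_) (fun n => ?_)
  · have hlog := Real.log_le_sub_one_of_pos (div_pos (hlampos n) hN)
    rw [Real.log_div (hlampos n).ne' hN.ne'] at hlog
    calc (N - lam n) * c n / N = (1 - lam n / N) * c n := by field_simp
      _ ≤ _ := mul_le_mul_of_nonneg_right (by linarith) (hc n)
  · have hlog := Real.log_le_sub_one_of_pos (div_pos hN (hlampos n))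
    rw [Real.log_div hN.ne' (hlampos n).ne'] at hlog
    have := hlampos n
    calc _ ≤ (N / lam n - 1) * c n := mul_le_mul_of_nonneg_right hlog (hc n)
      _ = (N - lam n) * c n / lam n := by field_simp

/-- For large `n`, `M_n(N)` is invertible, the series `Σ_{j≥1} N^{n−j} s_n(N)^j`
converges, and `(ln N − ln λ_n)/N^{−n}` and the series have a common limit. -/
theorem fullshift_entropy_drop_series (N k : ℕ) (hN : 2 ≤ N) (x : Fin k → ℕ → Fin N)
    (hdist : ∀ n : ℕ, 1 ≤ n → ∀ i j : Fin k, i ≠ j →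
      prefixWord (x i) n ≠ prefixWord (x j) n)
    (lam : ℕ → ℝ) (hlampos : ∀ n, 0 < lam n)
    (hlam : ∀ n : ℕ,
      entropy (perturbFamily (Set.univ : Set (ℤ → Fin N)) (prefixFamily x n)) =
        Real.log (lam n))
    (α : Matrix (Fin k) (Fin k) ℝ)
    (hα : ∀ i j : Fin k,
      Filter.Tendsto (fun n : ℕ => corrMatrix x n (N : ℝ) i j / (N : ℝ) ^ n)
        Filter.atTop (nhds (α i j)))
    (hαinv : IsUnit α.det) :
    (∃ n₀ : ℕ, ∀ n : ℕ, n₀ ≤ n →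
      IsUnit (corrMatrix x n (N : ℝ)).det ∧
      Summable (fun j : ℕ => (N : ℝ) ^ n * (snSum x n (N : ℝ) / (N : ℝ)) ^ (j + 1))) ∧
    ∃ L : ℝ,
      Filter.Tendsto
        (fun n : ℕ => (Real.log N - Real.log (lam n)) * (N : ℝ) ^ n)
        Filter.atTop (nhds L) ∧
      Filter.Tendsto
        (fun n : ℕ => ∑' j : ℕ, (N : ℝ) ^ n * (snSum x n (N : ℝ) / (N : ℝ)) ^ (j + 1))
        Filter.atTop (nhds L) := by
  have hN0 : (0 : ℝ) < N := by positivity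
  have hN1 : (1 : ℝ) < N := by exact_mod_cast hN
  have : Nontrivial (Fin N) := Fin.nontrivial_iff_two_le.2 hN
  have hlen : ∀ n, ∀ j, (prefixWord (x j) n).length = n := fun n j => by simp [prefixWord]
  have hhead : ∀ n, 1 ≤ n → Function.Injective fun j => (prefixWord (x j) n).head? := by
    intro n hn i j hij
    by_contra hne
    refine hdist 1 le_rfl i j hne ?_
    obtain ⟨m, rfl⟩ := Nat.exists_eq_add_of_le' hn
    simpa [prefixWord, List.range_succ_eq_map] using hij
  let ε : ℕ → ℝ := fun n => 3 / 2 * k * (2 / 3 : ℝ) ^ n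
  have hε : Tendsto (fun n : ℕ => (n : ℝ) ^ 2 * ε n) atTop (𝓝 0) := by
    have := (tendsto_pow_const_mul_const_pow_of_abs_lt_one 2
      (r := (2 / 3 : ℝ)) (by rw [abs_of_pos] <;> norm_num)).const_mul (3 / 2 * k : ℝ)
    rw [mul_zero] at this
    exact this.congr fun n => by simp only [ε]; ring
  have hε0 : Tendsto ε atTop (𝓝 0) := by
    simpa using (tendsto_pow_atTop_nhds_zero_of_lt_one (r := (2 / 3 : ℝ))
      (by norm_num) (by norm_num)).const_mul (3 / 2 * k : ℝ)
  have hle : ∀ n, 2 ≤ n → lam n ≤ N := fun n hn => by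
    simpa using le_card_of_entropy_eq (hlampos n) (hlam n) hn (hlen n) (hhead n (by omega))
  have hge : ∀ᶠ n in atTop, N - ε n ≤ lam n := by
    filter_upwards [eventually_ge_atTop 2, hε0.eventually_le_const (u := 1 / 2) (by norm_num)]
      with n hn hεn
    obtain ⟨m, rfl⟩ := Nat.exists_eq_add_of_le' (show 1 ≤ n by omega)
    have hN2 : (2 : ℝ) ≤ N := by exact_mod_cast hN
    refine le_of_card_le_mul_pow (hlampos _) (hlam _) (n := m) (by omega) (hlen _)
      (hhead _ (by omega)) (by linarith) ?_
    simp only [Fintype.card_fin, sub_sub_cancel]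
    calc (k : ℝ) = k * (2 / 3 * (3 / 2)) ^ m := by norm_num
      _ ≤ k * (2 / 3 * (N - ε (m + 1))) ^ m := by gcongr; linarith
      _ = ε (m + 1) * (N - ε (m + 1)) ^ m := by
        rw [mul_pow]
        simp only [ε, pow_succ]
        ring
  have habs : ∀ᶠ n in atTop, |lam n - N| ≤ ε n := by
    filter_upwards [hge, eventually_ge_atTop 2] with n h1 h2
    rw [abs_sub_comm, abs_of_nonneg (sub_nonneg.2 (hle n h2))]
    linarith
  have hlimlam : Tendsto lam atTop (𝓝 (N : ℝ)) := by
    rw [← tendsto_sub_nhds_zero_iff]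
    exact squeeze_zero_norm' habs hε0
  have hB : Tendsto (fun n => ((N : ℝ) ^ n)⁻¹ • corrMatrix x n (N : ℝ)) atTop (𝓝 α) :=
    tendsto_smul_corrMatrix_of_tendsto (by omega) hα (by simp) (by simp)
  have hC : Tendsto (fun n => ((N : ℝ) ^ n)⁻¹ • corrMatrix x n (lam n)) atTop (𝓝 α) := by
    refine tendsto_smul_corrMatrix_of_tendsto (by omega) hα ?_ ?_
    · filter_upwards [eventually_ge_atTop 2] with n hn
      rw [abs_of_pos (hlampos n)]
      exact hle n hn
    · refine squeeze_zero' (by filter_upwards with n; positivity) ?_ hε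
      filter_upwards [habs] with n hn
      gcongr
  set S := ∑ i, ∑ j, α⁻¹ i j
  have hunit : ∀ z : ℕ → ℝ,
      Tendsto (fun n => ((N : ℝ) ^ n)⁻¹ • corrMatrix x n (z n)) atTop (𝓝 α) →
      ∀ᶠ n in atTop, IsUnit (corrMatrix x n (z n)).det := by
    intro z hz
    have := ((continuous_id.matrix_det).tendsto α).comp hz
    filter_upwards [this.eventually_ne hαinv.ne_zero] with n hn
    exact (isUnit_det_smul_iff (inv_ne_zero (by positivity))).1 (isUnit_iff_ne_zero.2 hn)
  have hS : ∀ z : ℕ → ℝ,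
      Tendsto (fun n => ((N : ℝ) ^ n)⁻¹ • corrMatrix x n (z n)) atTop (𝓝 α) →
      Tendsto (fun n => snSum x n (z n) * (N : ℝ) ^ n) atTop (𝓝 S) := by
    intro z hz
    refine (tendsto_sum_inv hz hαinv).congr' ?_
    filter_upwards [hunit z hz] with n hn
    rw [sum_inv_smul hn (inv_ne_zero (by positivity)), inv_inv, mul_comm, snSum]
  have hs0 : Tendsto (fun n => snSum x n (N : ℝ)) atTop (𝓝 0) := by
    have := (hS _ hB).mul (tendsto_pow_atTop_nhds_zero_of_lt_one (r := (N : ℝ)⁻¹)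
      (by positivity) (inv_lt_one_of_one_lt₀ hN1))
    rw [mul_zero] at this
    refine this.congr fun n => ?_
    rw [inv_pow, mul_assoc, mul_inv_cancel₀ (by positivity), mul_one]
  have hq0 : Tendsto (fun n => snSum x n (N : ℝ) / N) atTop (𝓝 0) := by
    simpa using hs0.div_const (N : ℝ)
  have hq : ∀ᶠ n in atTop, |snSum x n (N : ℝ) / N| < 1 := by
    have := hq0.abs
    rw [abs_zero] at this
    exact this.eventually_lt_const one_pos
  have hsum : ∀ᶠ n in atTop,
      HasSum (fun j : ℕ => (N : ℝ) ^ n * (snSum x n (N : ℝ) / (N : ℝ)) ^ (j + 1))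
        (snSum x n (N : ℝ) * N ^ n / N * (1 - snSum x n (N : ℝ) / N)⁻¹) := by
    filter_upwards [hq] with n hn
    refine ((hasSum_geometric_of_abs_lt_one hn).mul_left
      (snSum x n (N : ℝ) * N ^ n / N)).congr_fun fun j => ?_
    rw [pow_succ]
    ring
  refine ⟨eventually_atTop.1 ((hunit _ hB).and (hsum.mono fun _ h => h.summable)), S / N, ?_, ?_⟩
  · refine tendsto_log_sub_log_mul hN0 hlampos hlimlam (fun n => by positivity) ?_
    refine (hS _ hC).congr' ?_
    filter_upwards [hunit _ hC, eventually_ge_atTop 2] with n hn hn2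
    congr 1
    have h := sum_inv_corrPolyMatrix_eq (hlampos n) (hlam n) hn2 (hlen n)
      (hhead n (by omega)) hn
    rw [Fintype.card_fin] at h
    exact h
  · have : Tendsto (fun n => snSum x n (N : ℝ) * N ^ n / N * (1 - snSum x n (N : ℝ) / N)⁻¹)
        atTop (𝓝 (S / N * (1 - 0)⁻¹)) :=
      ((hS _ hB).div_const _).mul ((tendsto_const_nhds.sub hq0).inv₀ (by norm_num))
    rw [sub_zero, inv_one, mul_one] at this
    exact this.congr' (hsum.mono fun _ h => h.tsum_eq.symm)
end

section
/- Let S ⊆ ℕ₀ be nonempty, X = X_S, n ≥ 1, and suppose w = 0^n ∈ L(X) (which holds provided some s ∈ S satisfies s ≥ n, or S is infinite). If S' := {s ∈ S : s < n} is nonempty, then X_w = X_{S'}; consequently h(X_{0^n}) = ln λ', where λ' is the unique real solution of Σ_{s∈S'} z^{−(s+1)} = 1, and h(X_{0^n}) → h(X) as n → ∞. -/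
open Filter Topology

section SGap

/-- The gap condition: between any two successive occurrences of `1` in `x`,
the number of `0`'s lies in `S`. -/
def gapsIn (S : Set ℕ) (x : ℤ → Fin 2) : Prop :=
  ∀ i j : ℤ, i < j → x i = 1 → x j = 1 → (∀ k : ℤ, i < k → k < j → x k = 0) →
    (j - i - 1).toNat ∈ S

/-- `1` occurs unboundedly in both directions. -/
def onesUnbounded (x : ℤ → Fin 2) : Prop :=
  (∀ n : ℤ, ∃ i > n, x i = 1) ∧ (∀ n : ℤ, ∃ i < n, x i = 1)

/-- The `S`-gap shift: gaps between successive `1`'s lie in `S`; when `S` is finite,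
`1` is required to occur infinitely often in both directions, while for infinite `S`
sequences beginning or ending with an infinite run of `0`'s are also allowed. -/
def SgapShift (S : Set ℕ) : Set (ℤ → Fin 2) :=
  { x | gapsIn S x ∧ (S.Infinite ∨ onesUnbounded x) }

/-- `T_R(z) = Σ_{n ∈ R} z^{-(n+1)}`. -/
noncomputable def TR (R : Set ℕ) (z : ℝ) : ℝ := ∑' n : R, (z ^ ((n : ℕ) + 1))⁻¹

/-- `S_m = { n − m : n ∈ S, n ≥ m }`. -/
def shiftSet (S : Set ℕ) (m : ℕ) : Set ℕ := { p | ∃ n ∈ S, m ≤ n ∧ p = n - m }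

/-- A word of the form `0^k u 0^{k'}` with `u` starting and ending with `1`,
`k, k' ∈ S ∪ {0}`, containing `w` as a subword. -/
def TildeForm (S : Set ℕ) (w v : List (Fin 2)) : Prop :=
  w <:+: v ∧ ∃ (k k' : ℕ) (u : List (Fin 2)),
    (k ∈ S ∨ k = 0) ∧ (k' ∈ S ∨ k' = 0) ∧ u.head? = some 1 ∧ u.getLast? = some 1 ∧
    v = List.replicate k 0 ++ u ++ List.replicate k' 0

/-- `wt = w̃`: the smallest word of tilde form containing `w`. -/
def IsTilde (S : Set ℕ) (w wt : List (Fin 2)) : Prop :=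
  TildeForm S w wt ∧ ∀ v, TildeForm S w v → wt.length ≤ v.length

end SGap

open scoped Classical in
noncomputable def gapSum (S : Set ℕ) (N : ℕ) (z : ℝ) : ℝ :=
  ∑ s ∈ (Finset.range N).filter (· ∈ S), (z ^ (s + 1))⁻¹

def translateZ {A : Type*} (x : ℤ → A) (k : ℤ) : ℤ → A := fun i => x (i + k)

def window {A : Type*} (x : ℤ → A) (N : ℕ) : List A := (List.range N).map fun i : ℕ => x i

def oneWords (S : Set ℕ) (N : ℕ) : Set (List (Fin 2)) :=
  { l | ∃ x ∈ SgapShift S, x 0 = 1 ∧ l = window x N }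

def gapBlock (s : ℕ) : List (Fin 2) := 1 :: List.replicate s 0

section Window

variable {A : Type*}

lemma length_window (x : ℤ → A) (N : ℕ) : (window x N).length = N := by simp [window]

lemma window_add (x : ℤ → A) (a b : ℕ) :
    window x (a + b) = window x a ++ window (translateZ x a) b := by
  simp [window, translateZ, List.range_add, Function.comp_def, add_comm]

lemma window_congr {x y : ℤ → A} {N : ℕ} (h : ∀ i : ℕ, i < N → x i = y i) :
    window x N = window y N := by
  apply List.map_congr_left
  intro i hi
  exact h i (List.mem_range.1 hi)

lemma window_eq_replicate {x : ℤ → A} {N : ℕ} {a : A} (h : ∀ i : ℕ, i < N → x i = a) :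
    window x N = List.replicate N a := by
  rw [window_congr (y := fun _ => a) h]
  simp [window]

lemma window_succ (x : ℤ → A) (N : ℕ) :
    window x (N + 1) = x 0 :: window (translateZ x 1) N := by
  rw [add_comm, window_add]
  simp [window]

lemma window_eq_gapBlock {x : ℤ → Fin 2} {s : ℕ} (h1 : x 0 = 1)
    (h0 : ∀ i : ℕ, i < s → x (i + 1) = 0) : window x (s + 1) = gapBlock s := by
  rw [window_succ, h1, gapBlock, window_eq_replicate (a := 0)]
  exact h0

lemma occursIn_iff_window {w : List A} {x : ℤ → A} :
    occursIn w x ↔ ∃ i : ℤ, w = window (translateZ x i) w.length := by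
  refine exists_congr fun i => ⟨fun h => ?_, fun h k => ?_⟩
  · apply List.ext_get
    · simp [length_window]
    · intro k h1 h2
      rw [← h ⟨k, h1⟩]
      simp [window, translateZ, add_comm]
  · have : w.get k = (window (translateZ x i) w.length).get ⟨k, by simp [length_window]⟩ := by
      simp [← h]
    rw [this]
    simp [window, translateZ, add_comm]

lemma occursIn_replicate {a : A} {n : ℕ} {x : ℤ → A} :
    occursIn (List.replicate n a) x ↔ ∃ i : ℤ, ∀ k : ℕ, k < n → x (i + k) = a := by
  refine exists_congr fun i => ⟨fun h k hk => ?_, fun h k => ?_⟩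
  · have := h ⟨k, by simpa using hk⟩
    simpa using this
  · simpa using h k (by simpa using k.2)

end Window

lemma fin_two_eq_zero {a : Fin 2} (h : a ≠ 1) : a = 0 := by omega

lemma translateZ_mem_SgapShift {S : Set ℕ} {x : ℤ → Fin 2} (hx : x ∈ SgapShift S) (k : ℤ) :
    translateZ x k ∈ SgapShift S := by
  obtain ⟨hg, hu⟩ := hx
  refine ⟨fun i j hij hi hj h0 => ?_, hu.imp id fun hu => ⟨fun n => ?_, fun n => ?_⟩⟩
  · have := hg (i + k) (j + k) (by omega) hi hj fun l h1 h2 => by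
      have := h0 (l - k) (by omega) (by omega)
      simpa [translateZ] using this
    rwa [show j + k - (i + k) - 1 = j - i - 1 by ring] at this
  · obtain ⟨i, hi, h⟩ := hu.1 (n + k)
    exact ⟨i - k, by omega, by simpa [translateZ] using h⟩
  · obtain ⟨i, hi, h⟩ := hu.2 (n + k)
    exact ⟨i - k, by omega, by simpa [translateZ] using h⟩

lemma mem_langN_SgapShift {S : Set ℕ} {N : ℕ} {l : List (Fin 2)} :
    l ∈ langN (SgapShift S) N ↔ ∃ x ∈ SgapShift S, l = window x N := by
  constructor
  · rintro ⟨⟨x, hx, h⟩, rfl⟩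
    obtain ⟨i, hi⟩ := occursIn_iff_window.1 h
    exact ⟨_, translateZ_mem_SgapShift hx i, hi⟩
  · rintro ⟨x, hx, rfl⟩
    refine ⟨⟨x, hx, occursIn_iff_window.2 ⟨0, ?_⟩⟩, length_window x N⟩
    rw [length_window]
    exact window_congr fun i _ => by simp [translateZ]

lemma oneWords_subset_langN (S : Set ℕ) (N : ℕ) : oneWords S N ⊆ langN (SgapShift S) N := by
  rintro l ⟨x, hx, -, rfl⟩
  exact mem_langN_SgapShift.2 ⟨x, hx, rfl⟩

lemma finite_langN {A : Type*} [Finite A] (X : Set (ℤ → A)) (N : ℕ) : (langN X N).Finite :=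
  (List.finite_length_eq A N).subset fun _ h => h.2

lemma finite_oneWords (S : Set ℕ) (N : ℕ) : (oneWords S N).Finite :=
  (finite_langN _ N).subset (oneWords_subset_langN S N)

lemma ncard_langN_le (X : Set (ℤ → Fin 2)) (N : ℕ) : (langN X N).ncard ≤ 2 ^ N := by
  have h : langN X N ⊆ Set.range (List.ofFn : (Fin N → Fin 2) → List (Fin 2)) := by
    rintro l ⟨-, rfl⟩
    exact ⟨l.get, List.ofFn_get l⟩
  calc (langN X N).ncard ≤ _ := Set.ncard_le_ncard h (Set.finite_range _)
    _ ≤ (Set.univ : Set (Fin N → Fin 2)).ncard := by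
      rw [← Set.image_univ]; exact Set.ncard_image_le Set.finite_univ
    _ = 2 ^ N := by simp [Set.ncard_univ]

/-! ### The perturbation by a word of zeros -/

lemma perturb_SgapShift_replicate_zero (S : Set ℕ) (n : ℕ) :
    perturb (SgapShift S) (List.replicate n 0) = SgapShift { s ∈ S | s < n } := by
  ext x
  have hfin : ¬ { s ∈ S | s < n }.Infinite := by
    rw [Set.not_infinite]
    exact (Set.finite_lt_nat n).subset fun _ h => h.2
  simp only [perturb, Set.mem_ofPred_eq, SgapShift, hfin, false_or, occursIn_replicate]
  push Not
  constructor
  · rintro ⟨⟨hg, -⟩, hno⟩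
    refine ⟨fun i j hij hi hj h0 => ⟨hg i j hij hi hj h0, ?_⟩, fun m => ?_, fun m => ?_⟩
    · obtain ⟨k, hk, h⟩ := hno (i + 1)
      by_contra hlt
      exact h (h0 _ (by omega) (by omega))
    · obtain ⟨k, hk, h⟩ := hno (m + 1)
      exact ⟨_, by omega, by_contra fun h1 => h (fin_two_eq_zero h1)⟩
    · obtain ⟨k, hk, h⟩ := hno (m - n)
      exact ⟨_, by omega, by_contra fun h1 => h (fin_two_eq_zero h1)⟩
  · rintro ⟨hg, hu⟩
    refine ⟨⟨fun i j hij hi hj h0 => (hg i j hij hi hj h0).1, Or.inr hu⟩, fun i => ?_⟩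
    by_contra! h0
    obtain ⟨a, ⟨ha, ha1⟩, hamax⟩ := Int.exists_greatest_of_bdd (P := fun a => a < i ∧ x a = 1)
      ⟨i, fun a h => h.1.le⟩ (hu.2 i)
    obtain ⟨b, ⟨hb, hb1⟩, hbmin⟩ := Int.exists_least_of_bdd (P := fun b => a < b ∧ x b = 1)
      ⟨a, fun b h => h.1.le⟩ (hu.1 a)
    have hbi : i + n ≤ b := by
      by_contra hlt
      by_cases hbi : b < i
      · have := hamax b ⟨hbi, hb1⟩
        omega
      · have := h0 (b - i).toNat (by omega)
        rw [show i + ((b - i).toNat : ℤ) = b by omega, hb1] at this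
        simp at this
    have := (hg a b hb ha1 hb1 fun k h1 h2 => fin_two_eq_zero fun hk => by
      have := hbmin k ⟨h1, hk⟩
      omega).2
    omega

/-! ### Recursive bounds -/

open scoped Classical in
lemma oneWords_subset (S : Set ℕ) (N : ℕ) :
    oneWords S (N + 1) ⊆ {gapBlock N} ∪
      ⋃ s ∈ (Finset.range N).filter (· ∈ S), (gapBlock s ++ ·) '' oneWords S (N - s) := by
  rintro l ⟨x, hx, hx0, rfl⟩
  by_cases h : ∃ s : ℕ, s < N ∧ x (s + 1) = 1
  · right
    have hmin : ∀ i : ℕ, i < Nat.find h → x (i + 1) = 0 := fun i hi =>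
      fin_two_eq_zero fun h1 => Nat.find_min h hi ⟨hi.trans (Nat.find_spec h).1, h1⟩
    obtain ⟨hs, hs1⟩ := Nat.find_spec h
    generalize Nat.find h = s at hmin hs hs1
    have hsS : s ∈ S := by
      have := hx.1 0 (s + 1) (by omega) hx0 hs1 fun k h1 h2 => by
        have := hmin (k - 1).toNat (by omega)
        rwa [show ((k - 1).toNat : ℤ) + 1 = k by omega] at this
      rwa [show ((s : ℤ) + 1 - 0 - 1).toNat = s by omega] at this
    simp only [Set.mem_iUnion]
    refine ⟨s, by simp [hs, hsS], _, ⟨_, translateZ_mem_SgapShift hx (s + 1), ?_, rfl⟩, ?_⟩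
    · simpa [translateZ] using hs1
    · conv_rhs => rw [show N + 1 = (s + 1) + (N - s) by omega, window_add]
      simp [window_eq_gapBlock hx0 hmin]
  · left
    push Not at h
    exact window_eq_gapBlock hx0 fun i hi => fin_two_eq_zero (h i hi)

lemma append_mem_oneWords {S : Set ℕ} {N s : ℕ} (hs : s ∈ S) {u : List (Fin 2)}
    (hu : u ∈ oneWords S N) : gapBlock s ++ u ∈ oneWords S (s + 1 + N) := by
  obtain ⟨x, ⟨hg, hu⟩, hx0, rfl⟩ := hu
  set y : ℤ → Fin 2 := fun i => if i ≤ 0 then x i else if i ≤ s then 0 else x (i - (s + 1)) with hy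
  have hle : ∀ i ≤ 0, y i = x i := fun i hi => if_pos hi
  have hmid : ∀ i : ℤ, 0 < i → i ≤ s → y i = 0 := fun i hi h => by
    simp only [hy]; rw [if_neg (by omega), if_pos h]
  have hgt : ∀ i, (s : ℤ) < i → y i = x (i - (s + 1)) := fun i h => by
    simp only [hy]; rw [if_neg (by omega), if_neg (by omega)]
  have hy0 : y 0 = 1 := by rw [hle 0 le_rfl, hx0]
  have hys : y (s + 1) = 1 := by rw [hgt _ (by omega), sub_self, hx0]
  refine ⟨y, ⟨fun i j hij hi hj h0 => ?_, hu.imp id fun hu => ⟨fun n => ?_, fun n => ?_⟩⟩, hy0, ?_⟩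
  · rcases le_or_gt j 0 with hj0 | hj0
    · exact hg i j hij (hle i (by omega) ▸ hi) (hle j hj0 ▸ hj) fun k h1 h2 =>
        hle k (by omega) ▸ h0 k h1 h2
    have hjs : (s : ℤ) < j := by
      by_contra hjs
      rw [hmid j hj0 (by omega)] at hj
      simp at hj
    rcases lt_or_ge (s : ℤ) i with his | his
    · have := hg (i - (s + 1)) (j - (s + 1)) (by omega) (hgt i his ▸ hi) (hgt j hjs ▸ hj)
        fun k h1 h2 => by
          have := h0 (k + (s + 1)) (by omega) (by omega)
          rwa [hgt _ (by omega), add_sub_cancel_right] at this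
      rwa [show j - (s + 1) - (i - (s + 1)) - 1 = j - i - 1 by ring] at this
    have hi0 : i ≤ 0 := by
      by_contra hi0
      rw [hmid i (by omega) his] at hi
      simp at hi
    have hi0 : i = 0 := by
      by_contra hne
      have := h0 0 (by omega) hj0
      simp [hy0] at this
    have hj : j = s + 1 := by
      by_contra hne
      have := h0 (s + 1) (by omega) (by omega)
      simp [hys] at this
    rwa [hi0, hj, show ((s : ℤ) + 1 - 0 - 1).toNat = s by omega]
  · obtain ⟨i, hi, h⟩ := hu.1 (max n 0)
    exact ⟨i + (s + 1), by omega, by rw [hgt _ (by omega), add_sub_cancel_right, h]⟩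
  · obtain ⟨i, hi, h⟩ := hu.2 (min n 0)
    exact ⟨i, by omega, by rw [hle _ (by omega), h]⟩
  · rw [window_add, window_eq_gapBlock hy0 fun i hi => hmid _ (by omega) (by omega)]
    congr 1
    refine window_congr fun i _ => ?_
    simp only [translateZ]
    rw [hgt _ (by push_cast; omega)]
    push_cast
    rw [add_sub_cancel_right]

lemma langN_subset (S : Set ℕ) (N : ℕ) :
    langN (SgapShift S) N ⊆ {List.replicate N 0} ∪
      ⋃ a ∈ Finset.range N, (List.replicate a 0 ++ ·) '' oneWords S (N - a) := by
  intro l hl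
  obtain ⟨x, hx, rfl⟩ := mem_langN_SgapShift.1 hl
  by_cases h : ∃ a : ℕ, a < N ∧ x a = 1
  · right
    have hmin : ∀ i : ℕ, i < Nat.find h → x i = 0 := fun i hi =>
      fin_two_eq_zero fun h1 => Nat.find_min h hi ⟨hi.trans (Nat.find_spec h).1, h1⟩
    obtain ⟨ha, ha1⟩ := Nat.find_spec h
    generalize Nat.find h = a at hmin ha ha1
    simp only [Set.mem_iUnion]
    refine ⟨a, by simp [ha], _, ⟨_, translateZ_mem_SgapShift hx a, ?_, rfl⟩, ?_⟩
    · simpa [translateZ] using ha1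
    · conv_rhs => rw [show N = a + (N - a) by omega, window_add]
      simp [window_eq_replicate hmin]
  · left
    push Not at h
    exact window_eq_replicate fun i hi => fin_two_eq_zero (h i hi)

open scoped Classical in
lemma ncard_oneWords_le (S : Set ℕ) (N : ℕ) :
    (oneWords S (N + 1)).ncard ≤
      1 + ∑ s ∈ (Finset.range N).filter (· ∈ S), (oneWords S (N - s)).ncard := by
  have hfin : (⋃ s ∈ (Finset.range N).filter (· ∈ S),
      (gapBlock s ++ ·) '' oneWords S (N - s)).Finite :=
    Set.Finite.biUnion (Finset.finite_toSet _) fun s _ => (finite_oneWords _ _).image _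
  refine (Set.ncard_le_ncard (oneWords_subset S N) ((Set.finite_singleton _).union hfin)).trans ?_
  refine (Set.ncard_union_le _ _).trans ?_
  rw [Set.ncard_singleton]
  gcongr
  refine (Finset.set_ncard_biUnion_le _ _).trans (Finset.sum_le_sum fun s _ => ?_)
  exact Set.ncard_image_le (finite_oneWords _ _)

lemma ncard_langN_SgapShift_le (S : Set ℕ) (N : ℕ) :
    (langN (SgapShift S) N).ncard ≤ 1 + ∑ a ∈ Finset.range N, (oneWords S (N - a)).ncard := by
  have hfin : (⋃ a ∈ Finset.range N,
      (List.replicate a 0 ++ ·) '' oneWords S (N - a)).Finite :=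
    Set.Finite.biUnion (Finset.finite_toSet _) fun s _ => (finite_oneWords _ _).image _
  refine (Set.ncard_le_ncard (langN_subset S N) ((Set.finite_singleton _).union hfin)).trans ?_
  refine (Set.ncard_union_le _ _).trans ?_
  rw [Set.ncard_singleton]
  gcongr
  refine (Finset.set_ncard_biUnion_le _ _).trans (Finset.sum_le_sum fun s _ => ?_)
  exact Set.ncard_image_le (finite_oneWords _ _)

lemma takeWhile_gapBlock_append {S : Set ℕ} {N s : ℕ} {u : List (Fin 2)}
    (hu : u ∈ oneWords S (N + 1)) :
    ((gapBlock s ++ u).tail.takeWhile (· = 0)).length = s := by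
  obtain ⟨x, -, hx0, rfl⟩ := hu
  rw [window_succ, hx0, gapBlock, List.cons_append, List.tail_cons,
    List.takeWhile_append_of_pos]
  · simp
  · simp

lemma sum_ncard_oneWords_le {S : Set ℕ} {F : Finset ℕ} (hF : ∀ s ∈ F, s ∈ S) {N : ℕ}
    (hN : ∀ s ∈ F, s < N) :
    ∑ s ∈ F, (oneWords S (N - s)).ncard ≤ (oneWords S (N + 1)).ncard := by
  have hdisj : (F : Set ℕ).PairwiseDisjoint fun s => (gapBlock s ++ ·) '' oneWords S (N - s) := by
    intro s hs t ht hst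
    refine Set.disjoint_left.2 ?_
    rintro _ ⟨u, hu, rfl⟩ ⟨v, hv, h⟩
    obtain ⟨a, ha⟩ := Nat.exists_eq_add_of_lt (hN s hs)
    obtain ⟨b, hb⟩ := Nat.exists_eq_add_of_lt (hN t ht)
    rw [show N - s = a + 1 by omega] at hu
    rw [show N - t = b + 1 by omega] at hv
    apply hst
    rw [← takeWhile_gapBlock_append (s := s) hu, ← takeWhile_gapBlock_append (s := t) hv]
    exact congrArg (fun l : List (Fin 2) => (l.tail.takeWhile (· = 0)).length) h.symm
  have hsub : (⋃ s ∈ (F : Set ℕ), (gapBlock s ++ ·) '' oneWords S (N - s)) ⊆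
      oneWords S (N + 1) := by
    refine Set.iUnion₂_subset fun s hs => ?_
    rintro _ ⟨u, hu, rfl⟩
    have := append_mem_oneWords (hF s hs) hu
    rwa [show s + 1 + (N - s) = N + 1 by have := hN s hs; omega] at this
  calc ∑ s ∈ F, (oneWords S (N - s)).ncard
      = ∑ s ∈ F, ((gapBlock s ++ ·) '' oneWords S (N - s)).ncard :=
        Finset.sum_congr rfl fun s _ =>
          (Set.ncard_image_of_injective _ (List.append_right_injective _)).symm
    _ = (⋃ s ∈ (F : Set ℕ), (gapBlock s ++ ·) '' oneWords S (N - s)).ncard := by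
        rw [Set.Finite.ncard_biUnion F.finite_toSet
          (fun s _ => (finite_oneWords _ _).image _) hdisj,
          finsum_mem_coe_finset]
    _ ≤ _ := Set.ncard_le_ncard hsub (finite_oneWords _ _)

lemma oneWords_nonempty {S : Set ℕ} (hS : S.Nonempty) (N : ℕ) : (oneWords S N).Nonempty := by
  obtain ⟨s, hs⟩ := hS
  refine ⟨_, fun i => if ((s : ℤ) + 1) ∣ i then 1 else 0,
    ⟨fun i j hij hi hj h0 => ?_, Or.inr ⟨fun n => ?_, fun n => ?_⟩⟩, by simp, rfl⟩
  · simp only [ite_eq_left_iff, zero_ne_one, imp_false, not_not] at hi hj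
    have hle : (s : ℤ) + 1 ≤ j - i := Int.le_of_dvd (by omega) (dvd_sub hj hi)
    have hj : j = i + (s + 1) := by
      by_contra hne
      have := h0 (i + (s + 1)) (by omega) (by omega)
      simp [dvd_add hi dvd_rfl] at this
    rwa [hj, show (i + ((s : ℤ) + 1) - i - 1).toNat = s by omega]
  · exact ⟨(s + 1) * (|n| + 1), by nlinarith [le_abs_self n, abs_nonneg n], by simp⟩
  · exact ⟨(s + 1) * -(|n| + 1), by nlinarith [neg_abs_le n, abs_nonneg n], by simp⟩

/-! ### Exponential bounds on word counts -/

lemma ncard_oneWords_le_mul_pow {S : Set ℕ} {z : ℝ} (hz : 1 ≤ z) (hS : ∀ N, gapSum S N z ≤ 1)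
    (N : ℕ) : ((oneWords S N).ncard : ℝ) ≤ (N + 1) * z ^ N := by
  classical
  induction N using Nat.strong_induction_on with
  | _ N ih =>
  cases N with
  | zero =>
    have h : (oneWords S 0).ncard ≤ 2 ^ 0 :=
      (Set.ncard_le_ncard (oneWords_subset_langN S 0) (finite_langN _ _)).trans (ncard_langN_le _ _)
    simpa using h
  | succ N =>
    have hz0 : z ≠ 0 := by positivity
    have hrec : ((oneWords S (N + 1)).ncard : ℝ) ≤
        1 + ∑ s ∈ (Finset.range N).filter (· ∈ S), ((oneWords S (N - s)).ncard : ℝ) := by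
      exact_mod_cast ncard_oneWords_le S N
    have hsum : ∑ s ∈ (Finset.range N).filter (· ∈ S), ((oneWords S (N - s)).ncard : ℝ) ≤
        (N + 1) * z ^ (N + 1) * gapSum S N z := by
      rw [gapSum, Finset.mul_sum]
      refine Finset.sum_le_sum fun s hs => ?_
      have hsN : s < N := Finset.mem_range.1 (Finset.mem_filter.1 hs).1
      have hpow : z ^ (N - s) = z ^ (N + 1) * (z ^ (s + 1))⁻¹ := by
        rw [← pow_sub₀ z hz0 (by omega), show N + 1 - (s + 1) = N - s by omega]
      rw [mul_assoc, ← hpow]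
      refine (ih _ (by omega)).trans ?_
      gcongr
      omega
    have hpow1 : 1 ≤ z ^ (N + 1) := one_le_pow₀ hz
    have := mul_le_mul_of_nonneg_left (hS N) (show 0 ≤ ((N : ℝ) + 1) * z ^ (N + 1) by positivity)
    push_cast
    linarith

lemma ncard_langN_SgapShift_le_mul_pow {S : Set ℕ} {z : ℝ} (hz : 1 ≤ z)
    (hS : ∀ N, gapSum S N z ≤ 1) (N : ℕ) :
    ((langN (SgapShift S) N).ncard : ℝ) ≤ (N + 1) ^ 2 * z ^ N := by
  have h : ((langN (SgapShift S) N).ncard : ℝ) ≤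
      1 + ∑ a ∈ Finset.range N, ((oneWords S (N - a)).ncard : ℝ) := by
    exact_mod_cast ncard_langN_SgapShift_le S N
  have hsum : ∑ a ∈ Finset.range N, ((oneWords S (N - a)).ncard : ℝ) ≤
      ∑ _a ∈ Finset.range N, ((N : ℝ) + 1) * z ^ N := by
    refine Finset.sum_le_sum fun a _ => (ncard_oneWords_le_mul_pow hz hS _).trans ?_
    gcongr <;> omega
  rw [Finset.sum_const, Finset.card_range, nsmul_eq_mul] at hsum
  have : 1 ≤ z ^ N := one_le_pow₀ hz
  nlinarith

lemma pow_div_le_ncard_oneWords {S : Set ℕ} (hne : S.Nonempty) {z : ℝ} (hz : 1 ≤ z) {n : ℕ}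
    (hS : 1 ≤ gapSum S n z) (N : ℕ) : z ^ N / z ^ n ≤ ((oneWords S N).ncard : ℝ) := by
  classical
  have hz0 : z ≠ 0 := by positivity
  induction N using Nat.strong_induction_on with
  | _ N ih =>
  by_cases hN : N ≤ n
  · have h1 : 1 ≤ (oneWords S N).ncard :=
      (Set.ncard_pos (finite_oneWords S N)).2 (oneWords_nonempty hne N)
    calc z ^ N / z ^ n ≤ 1 := div_le_one_of_le₀ (pow_le_pow_right₀ hz hN) (by positivity)
      _ ≤ _ := by exact_mod_cast h1
  · obtain ⟨K, rfl⟩ : ∃ K, N = K + 1 := ⟨N - 1, by omega⟩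
    have hlt : ∀ s ∈ (Finset.range n).filter (· ∈ S), s < K := fun s hs => by
      have := Finset.mem_range.1 (Finset.mem_filter.1 hs).1
      omega
    have hrec : ∑ s ∈ (Finset.range n).filter (· ∈ S), ((oneWords S (K - s)).ncard : ℝ) ≤
        (oneWords S (K + 1)).ncard := by
      exact_mod_cast sum_ncard_oneWords_le (fun s hs => (Finset.mem_filter.1 hs).2) hlt
    refine le_trans ?_ hrec
    calc z ^ (K + 1) / z ^ n ≤ z ^ (K + 1) / z ^ n * gapSum S n z :=
          le_mul_of_one_le_right (by positivity) hS
      _ ≤ _ := by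
        rw [gapSum, Finset.mul_sum]
        refine Finset.sum_le_sum fun s hs => ?_
        have hpow : z ^ (K - s) = z ^ (K + 1) * (z ^ (s + 1))⁻¹ := by
          have := hlt s hs
          rw [← pow_sub₀ z hz0 (by omega), show K + 1 - (s + 1) = K - s by omega]
        rw [div_mul_eq_mul_div, ← hpow]
        exact ih _ (by omega)

/-! ### Entropy estimates -/

section Entropy

variable {X Y : Set (ℤ → Fin 2)}

lemma log_natCast_le_log {k : ℕ} {B : ℝ} (hB : 1 ≤ B) (h : (k : ℝ) ≤ B) :
    Real.log k ≤ Real.log B := by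
  rcases Nat.eq_zero_or_pos k with rfl | hk
  · simpa using Real.log_nonneg hB
  · exact Real.log_le_log (by exact_mod_cast hk) h

lemma entropy_seq_nonneg (X : Set (ℤ → Fin 2)) (N : ℕ) :
    0 ≤ Real.log ((langN X N).ncard) / N :=
  div_nonneg (Real.log_natCast_nonneg _) N.cast_nonneg

lemma isCoboundedUnder_entropy_seq (X : Set (ℤ → Fin 2)) :
    atTop.IsCoboundedUnder (· ≤ ·) fun N : ℕ => Real.log ((langN X N).ncard) / N :=
  IsBoundedUnder.isCoboundedUnder_le (isBoundedUnder_of ⟨0, entropy_seq_nonneg X⟩)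

lemma isBoundedUnder_entropy_seq (X : Set (ℤ → Fin 2)) :
    atTop.IsBoundedUnder (· ≤ ·) fun N : ℕ => Real.log ((langN X N).ncard) / N := by
  refine isBoundedUnder_of ⟨Real.log 2, fun N => ?_⟩
  refine div_le_of_le_mul₀ N.cast_nonneg (Real.log_nonneg one_le_two) ?_
  rw [mul_comm, ← Real.log_pow]
  exact log_natCast_le_log (one_le_pow₀ one_le_two) (by exact_mod_cast ncard_langN_le X N)

lemma entropy_mono (h : X ⊆ Y) : entropy X ≤ entropy Y := by
  refine limsup_le_limsup (Eventually.of_forall fun N => ?_) (isCoboundedUnder_entropy_seq X)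
    (isBoundedUnder_entropy_seq Y)
  have hsub : langN X N ⊆ langN Y N := fun w ⟨⟨x, hx, hw⟩, hN⟩ => ⟨⟨x, h hx, hw⟩, hN⟩
  have hle := Set.ncard_le_ncard hsub (finite_langN Y N)
  refine div_le_div_of_nonneg_right ?_ N.cast_nonneg
  rcases Nat.eq_zero_or_pos (langN X N).ncard with h0 | hpos
  · rw [h0, Nat.cast_zero, Real.log_zero]
    exact Real.log_natCast_nonneg _
  · exact Real.log_le_log (by exact_mod_cast hpos) (by exact_mod_cast hle)

lemma entropy_le_log {z : ℝ} (hz : 1 ≤ z)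
    (h : ∀ N : ℕ, ((langN X N).ncard : ℝ) ≤ (N + 1) ^ 2 * z ^ N) : entropy X ≤ Real.log z := by
  have hlog : Tendsto (fun N : ℕ => Real.log N / (N : ℝ)) atTop (𝓝 0) :=
    Real.isLittleO_log_id_atTop.tendsto_div_nhds_zero.comp tendsto_natCast_atTop_atTop
  have hlim : Tendsto (fun N : ℕ => Real.log 4 / N + 2 * (Real.log N / N) + Real.log z) atTop
      (𝓝 (Real.log z)) := by
    simpa using ((tendsto_const_div_atTop_nhds_zero_nat (Real.log 4)).add
      (hlog.const_mul 2)).add_const (Real.log z)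
  rw [← hlim.limsup_eq]
  refine limsup_le_limsup ?_ (isCoboundedUnder_entropy_seq X) hlim.isBoundedUnder_le
  filter_upwards [eventually_ge_atTop 1] with N hN
  have hN1 : (1 : ℝ) ≤ N := by exact_mod_cast hN
  have hpow : 1 ≤ z ^ N := one_le_pow₀ hz
  have hB : ((langN X N).ncard : ℝ) ≤ 4 * (N : ℝ) ^ 2 * z ^ N := by
    refine (h N).trans (mul_le_mul_of_nonneg_right ?_ (by positivity))
    nlinarith
  have hB1 : 1 ≤ 4 * (N : ℝ) ^ 2 * z ^ N := one_le_mul_of_one_le_of_one_le (by nlinarith) hpow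
  have := log_natCast_le_log hB1 hB
  rw [Real.log_mul (by positivity) (by positivity), Real.log_mul (by positivity) (by positivity),
    Real.log_pow, Real.log_pow] at this
  calc Real.log ((langN X N).ncard) / N
      ≤ (Real.log 4 + (2 : ℕ) * Real.log N + N * Real.log z) / N := by gcongr
    _ = _ := by push_cast; field_simp

lemma log_le_entropy {z C : ℝ} (hz : 0 < z) (hC : 0 < C)
    (h : ∀ N : ℕ, z ^ N / C ≤ ((langN X N).ncard : ℝ)) : Real.log z ≤ entropy X := by
  have hlim : Tendsto (fun N : ℕ => Real.log z - Real.log C / N) atTop (𝓝 (Real.log z)) := by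
    simpa using (tendsto_const_div_atTop_nhds_zero_nat (Real.log C)).const_sub (Real.log z)
  rw [← hlim.limsup_eq]
  refine limsup_le_limsup ?_ hlim.isCoboundedUnder_le (isBoundedUnder_entropy_seq X)
  filter_upwards [eventually_ge_atTop 1] with N hN
  have hN0 : (0 : ℝ) < N := by exact_mod_cast hN
  have := Real.log_le_log (by positivity) (h N)
  rw [Real.log_div (by positivity) (by positivity), Real.log_pow] at this
  calc Real.log z - Real.log C / N = (N * Real.log z - Real.log C) / N := by field_simp
    _ ≤ _ := by gcongr

end Entropy

/-! ### Entropy of gap shifts -/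

lemma entropy_SgapShift_le_log {S : Set ℕ} {z : ℝ} (hz : 1 ≤ z) (hS : ∀ N, gapSum S N z ≤ 1) :
    entropy (SgapShift S) ≤ Real.log z :=
  entropy_le_log hz (ncard_langN_SgapShift_le_mul_pow hz hS)

lemma gapSum_anti {S : Set ℕ} {N : ℕ} {y z : ℝ} (hy : 0 < y) (hyz : y ≤ z) :
    gapSum S N z ≤ gapSum S N y := by
  refine Finset.sum_le_sum fun s _ => ?_
  gcongr

lemma gapSum_le_gapSum {S T : Set ℕ} {M N : ℕ} (h : ∀ s ∈ S, s < M → s ∈ T ∧ s < N) {z : ℝ}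
    (hz : 0 < z) : gapSum S M z ≤ gapSum T N z := by
  classical
  refine Finset.sum_le_sum_of_subset_of_nonneg (fun s hs => ?_) fun _ _ _ => by positivity
  rw [Finset.mem_filter, Finset.mem_range] at hs ⊢
  exact (h s hs.2 hs.1).symm

lemma gapSum_lt_le (S : Set ℕ) (n N : ℕ) {z : ℝ} (hz : 0 < z) :
    gapSum { s ∈ S | s < n } N z ≤ gapSum S n z :=
  gapSum_le_gapSum (fun _ hs _ => hs) hz

lemma le_gapSum_lt (S : Set ℕ) (n : ℕ) {z : ℝ} (hz : 0 < z) :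
    gapSum S n z ≤ gapSum { s ∈ S | s < n } n z :=
  gapSum_le_gapSum (fun _ hs hn => And.intro (And.intro hs hn) hn) hz

lemma TR_lt_eq_gapSum (S : Set ℕ) (n : ℕ) (z : ℝ) : TR { s ∈ S | s < n } z = gapSum S n z := by
  classical
  have h : { s ∈ S | s < n } = ((Finset.range n).filter (· ∈ S) : Finset ℕ) := by
    ext s
    simp [and_comm]
  rw [TR, h, gapSum]
  exact Finset.tsum_subtype' _ fun s : ℕ => (z ^ (s + 1))⁻¹

lemma entropy_SgapShift_lt {S : Set ℕ} {n : ℕ} (hne : { s ∈ S | s < n }.Nonempty) {z : ℝ}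
    (hz : 1 ≤ z) (h : gapSum S n z = 1) :
    entropy (SgapShift { s ∈ S | s < n }) = Real.log z := by
  refine le_antisymm (entropy_SgapShift_le_log hz fun N => h ▸ gapSum_lt_le S n N (by positivity))
    (log_le_entropy (C := z ^ n) (by positivity) (by positivity) fun N => ?_)
  refine (pow_div_le_ncard_oneWords hne hz (h ▸ le_gapSum_lt S n (by positivity)) N).trans ?_
  exact_mod_cast Set.ncard_le_ncard (oneWords_subset_langN _ N) (finite_langN _ _)

lemma exists_gapSum_eq_one {S : Set ℕ} {n : ℕ} (hne : { s ∈ S | s < n }.Nonempty) :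
    ∃ z : ℝ, 1 ≤ z ∧ gapSum S n z = 1 := by
  classical
  have hcont : ContinuousOn (gapSum S n) (Set.Icc 1 (n + 1)) := by
    refine continuousOn_finsetSum _ fun s _ => ?_
    refine ContinuousOn.inv₀ (by fun_prop) fun z hz => ?_
    have : 0 < z := one_pos.trans_le hz.1
    positivity
  obtain ⟨s, hs, hsn⟩ := hne
  have h1 : 1 ≤ gapSum S n 1 := by
    have : 1 ≤ ((Finset.range n).filter (· ∈ S)).card :=
      Finset.card_pos.2 ⟨s, Finset.mem_filter.2 ⟨Finset.mem_range.2 hsn, hs⟩⟩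
    simpa [gapSum] using this
  have h2 : gapSum S n (n + 1) ≤ 1 := by
    have hcard : ((Finset.range n).filter (· ∈ S)).card ≤ n := by
      simpa using Finset.card_filter_le (Finset.range n) (· ∈ S)
    calc gapSum S n (n + 1) ≤ ((Finset.range n).filter (· ∈ S)).card • ((n : ℝ) + 1)⁻¹ := by
          refine Finset.sum_le_card_nsmul _ _ _ fun s _ => ?_
          gcongr
          exact le_self_pow₀ (by linarith [n.cast_nonneg (α := ℝ)]) (by omega)
      _ ≤ n • ((n : ℝ) + 1)⁻¹ := by gcongr
      _ ≤ 1 := by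
          rw [nsmul_eq_mul, ← div_eq_mul_inv]
          exact div_le_one_of_le₀ (by linarith) (by positivity)
  obtain ⟨z, hz, h⟩ := intermediate_value_Icc' (by linarith [n.cast_nonneg (α := ℝ)]) hcont ⟨h2, h1⟩
  exact ⟨z, hz.1, h⟩

lemma perturb_replicate_mono {A : Type*} (X : Set (ℤ → A)) (a : A) {m k : ℕ} (h : m ≤ k) :
    perturb X (List.replicate m a) ⊆ perturb X (List.replicate k a) := by
  refine fun x hx => ⟨hx.1, fun hk => hx.2 ?_⟩
  rw [occursIn_replicate] at hk ⊢
  obtain ⟨i, hi⟩ := hk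
  exact ⟨i, fun j hj => hi j (hj.trans_le h)⟩

lemma tendsto_entropy_perturb_replicate_zero {S : Set ℕ} (hS : S.Nonempty) :
    Tendsto (fun m : ℕ => entropy (perturb (SgapShift S) (List.replicate m (0 : Fin 2)))) atTop
      (𝓝 (entropy (SgapShift S))) := by
  refine tendsto_order.2 ⟨fun a ha => ?_, fun a ha => Eventually.of_forall fun m => ?_⟩
  · obtain ⟨k, hk⟩ : ∃ k : ℕ, a < entropy (perturb (SgapShift S) (List.replicate k 0)) := by
      by_contra! hle
      refine ha.not_ge ?_
      obtain ⟨s, hs⟩ := hS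
      have hroot : ∀ N : ℕ, s < N → ∃ z : ℝ, 1 ≤ z ∧ z ≤ Real.exp a ∧ gapSum S N z = 1 := by
        intro N hN
        have hne : { s ∈ S | s < N }.Nonempty := ⟨s, hs, hN⟩
        obtain ⟨z, hz, h⟩ := exists_gapSum_eq_one hne
        refine ⟨z, hz, ?_, h⟩
        rw [← Real.log_le_iff_le_exp (by positivity), ← entropy_SgapShift_lt hne hz h,
          ← perturb_SgapShift_replicate_zero]
        exact hle N
      have hexp : 1 ≤ Real.exp a := by
        obtain ⟨z, hz, hza, -⟩ := hroot (s + 1) (by omega)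
        exact hz.trans hza
      rw [← Real.log_exp a]
      refine entropy_SgapShift_le_log hexp fun N => ?_
      obtain ⟨z, hz, hza, h⟩ := hroot (max N (s + 1)) (by omega)
      calc gapSum S N (Real.exp a) ≤ gapSum S (max N (s + 1)) (Real.exp a) :=
            gapSum_le_gapSum (fun _ hs hN => ⟨hs, lt_max_of_lt_left hN⟩) (Real.exp_pos a)
        _ ≤ gapSum S (max N (s + 1)) z := gapSum_anti (by positivity) hza
        _ = 1 := h
    filter_upwards [eventually_ge_atTop k] with m hm
    exact hk.trans_le (entropy_mono (perturb_replicate_mono _ _ hm))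
  · exact (entropy_mono fun x hx => hx.1).trans_lt ha

/-- Perturbing an `S`-gap shift by the word `0^n` yields the `S'`-gap shift with
`S' = {s ∈ S : s < n}`; its entropy is `ln λ'` for the unique `λ' ≥ 1` solving
`Σ_{s∈S'} z^{−(s+1)} = 1`, and `h(X_{0^n}) → h(X)` as `n → ∞`. -/
theorem sgap_zero_word_perturbation (S : Set ℕ) (hS : S.Nonempty) (n : ℕ) (hn : 1 ≤ n)
    (hw : List.replicate n (0 : Fin 2) ∈ language (SgapShift S))
    (hS' : { s ∈ S | s < n }.Nonempty) :
    perturb (SgapShift S) (List.replicate n 0) = SgapShift { s ∈ S | s < n } ∧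
    (∀ lam' : ℝ, 1 ≤ lam' → TR { s ∈ S | s < n } lam' = 1 →
      entropy (perturb (SgapShift S) (List.replicate n 0)) = Real.log lam') ∧
    Filter.Tendsto
      (fun m : ℕ => entropy (perturb (SgapShift S) (List.replicate m (0 : Fin 2))))
      Filter.atTop (nhds (entropy (SgapShift S))) := by
  have hX := perturb_SgapShift_replicate_zero S n
  refine ⟨hX, fun lam' hlam h => ?_, tendsto_entropy_perturb_replicate_zero hS⟩
  rw [hX]
  exact entropy_SgapShift_lt hS' hlam (by rw [← TR_lt_eq_gapSum, h])
end
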